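/- Let (M, 𝒳) ⊨ GBC be countable. Then there is a GBC-realization 𝒴 for M with 𝒳 ⊊ 𝒴 which is minimal above 𝒳: there is no GBC-realization 𝒵 for M with 𝒳 ⊊ 𝒵 ⊊ 𝒴. Equivalently, the collection { 𝒴 : (M, 𝒴) ⊨ GBC and 𝒳 ⊊ 𝒴 } has minimal elements. -/

import Mathlib

/- A self-contained formalization framework for two-sorted second-order set theories
(Gödel–Bernays `GB`, Kelley–Morse `KM`, Elementary Transfinite Recursion `ETR`, ...).

A model of second-order set theory is given by a carrier type `α`, a domain `D : Set α`
of its sets, a membership relation `E : α → α → Prop`, and a collection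
`𝒳 : Set (Set α)` of classes (extensional classes are identified with subsets of the
first-order part). Schemas are formalized via a deep embedding `Fml` of the two-sorted
language: lower-case (set) variables and upper-case (class) variables, both indexed by ℕ. -/

namespace SOST

/-- Formulas of the two-sorted language of second-order set theory.
`memSS i j` is `xᵢ ∈ xⱼ`, `memSC i j` is `xᵢ ∈ Xⱼ`, `eqS i j` is `xᵢ = xⱼ`,
`allS` quantifies a set variable, `allC` a class variable. -/
inductive Fml : Type
  | memSS : ℕ → ℕ → Fml
  | memSC : ℕ → ℕ → Fml
  | eqS : ℕ → ℕ → Fml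
  | fal : Fml
  | imp : Fml → Fml → Fml
  | allS : ℕ → Fml → Fml
  | allC : ℕ → Fml → Fml
deriving DecidableEq

/-- Negation, defined from implication and falsity. -/
def Fml.neg (φ : Fml) : Fml := φ.imp .fal

variable {α : Type*}

/-- Tarskian satisfaction for the two-sorted language, over the structure with
first-order domain `D`, membership `E` and collection of classes `𝒳`.
Set quantifiers range over `D`; class quantifiers range over `𝒳`.
`s` assigns set variables, `c` assigns class variables. -/
def Sat (D : Set α) (E : α → α → Prop) (𝒳 : Set (Set α)) :
    Fml → (ℕ → α) → (ℕ → Set α) → Prop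
  | .memSS i j, s, _ => E (s i) (s j)
  | .memSC i j, s, c => s i ∈ c j
  | .eqS i j, s, _ => s i = s j
  | .fal, _, _ => False
  | .imp φ ψ, s, c => Sat D E 𝒳 φ s c → Sat D E 𝒳 ψ s c
  | .allS i φ, s, c => ∀ x ∈ D, Sat D E 𝒳 φ (Function.update s i x) c
  | .allC i φ, s, c => ∀ X ∈ 𝒳, Sat D E 𝒳 φ s (Function.update c i X)

/-- A formula is *elementary* (first-order) if it has no class quantifiers
(class variables may still occur freely, as parameters). -/
def Fml.IsElementary : Fml → Prop
  | .memSS _ _ => True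
  | .memSC _ _ => True
  | .eqS _ _ => True
  | .fal => True
  | .imp φ ψ => φ.IsElementary ∧ ψ.IsElementary
  | .allS _ φ => φ.IsElementary
  | .allC _ _ => False

/-- A formula is *pure* if it mentions no class variables at all
(it is a formula of the first-order language of set theory). -/
def Fml.IsPure : Fml → Prop
  | .memSS _ _ => True
  | .memSC _ _ => False
  | .eqS _ _ => True
  | .fal => True
  | .imp φ ψ => φ.IsPure ∧ ψ.IsPure
  | .allS _ φ => φ.IsPure
  | .allC _ _ => False

/-- Π¹₁ formulas: a single universal class quantifier followed by an elementary formula. -/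
def Fml.IsPi11 (φ : Fml) : Prop :=
  ∃ (i : ℕ) (ψ : Fml), ψ.IsElementary ∧ φ = Fml.allC i ψ

/-- Σ¹₁ formulas: an existential class quantifier (coded as `¬∀X¬`) followed by an
elementary formula. -/
def Fml.IsSigma11 (φ : Fml) : Prop :=
  ∃ (i : ℕ) (ψ : Fml), ψ.IsElementary ∧ φ = (Fml.allC i ψ.neg).neg

/-- `x` is internally transitive: members of members (within `D`) are members. -/
def IsTransIn (D : Set α) (E : α → α → Prop) (x : α) : Prop :=
  ∀ y ∈ D, E y x → ∀ z ∈ D, E z y → E z x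

/-- `x` is internally a (von Neumann) ordinal: a transitive set of transitive sets. -/
def IsOrdIn (D : Set α) (E : α → α → Prop) (x : α) : Prop :=
  x ∈ D ∧ IsTransIn D E x ∧ ∀ y ∈ D, E y x → IsTransIn D E y

/-- `p` is internally the Kuratowski ordered pair `⟨a, b⟩ = {{a}, {a, b}}`. -/
def IsKPair (D : Set α) (E : α → α → Prop) (p a b : α) : Prop :=
  p ∈ D ∧ a ∈ D ∧ b ∈ D ∧
    ∀ z ∈ D, (E z p ↔
      ((∀ w ∈ D, E w z ↔ w = a) ∨ (∀ w ∈ D, E w z ↔ (w = a ∨ w = b))))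

/-- For a class `R` of (internal) ordered pairs, `PairIn D E R a b` says
that the pair `⟨a, b⟩` belongs to `R`, i.e. `a R b`. -/
def PairIn (D : Set α) (E : α → α → Prop) (R : Set α) (a b : α) : Prop :=
  ∃ p ∈ R, IsKPair D E p a b

/-- `R` is a class of (internal) ordered pairs, i.e. a class binary relation. -/
def IsClassRel (D : Set α) (E : α → α → Prop) (R : Set α) : Prop :=
  ∀ z ∈ R, ∃ a b, a ∈ D ∧ b ∈ D ∧ IsKPair D E z a b

/-- The field of a class relation `R`. -/
def relFld (D : Set α) (E : α → α → Prop) (R : Set α) : Set α :=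
  {a | a ∈ D ∧ ∃ b, PairIn D E R a b ∨ PairIn D E R b a}

/-- The internal (first-order) characterization of well-foundedness for a class
relation `R` over a model of `GB`: every nonempty *set* all of whose members lie
in the field of `R` has an `R`-minimal element. -/
def IntWF (D : Set α) (E : α → α → Prop) (R : Set α) : Prop :=
  ∀ d ∈ D, (∃ z ∈ D, E z d) → (∀ z ∈ D, E z d → z ∈ relFld D E R) →
    ∃ m ∈ D, E m d ∧ ∀ z ∈ D, E z d → ¬ PairIn D E R z m

/-- The first-order `ZF` axioms, with the Separation and Replacement schemas ranging over
pure formulas of the language of set theory (with set parameters). -/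
structure ZFModel (D : Set α) (E : α → α → Prop) : Prop where
  nonempty : ∃ x, x ∈ D
  exten : ∀ x ∈ D, ∀ y ∈ D, (∀ z ∈ D, E z x ↔ E z y) → x = y
  pairing : ∀ x ∈ D, ∀ y ∈ D, ∃ p ∈ D, ∀ z ∈ D, E z p ↔ (z = x ∨ z = y)
  union : ∀ x ∈ D, ∃ u ∈ D, ∀ z ∈ D, E z u ↔ ∃ w ∈ D, E w x ∧ E z w
  power : ∀ x ∈ D, ∃ p ∈ D, ∀ z ∈ D, E z p ↔ ∀ w ∈ D, E w z → E w x
  infinity : ∃ I ∈ D, (∃ e ∈ D, E e I ∧ ∀ z ∈ D, ¬ E z e) ∧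
    ∀ x ∈ D, E x I → ∃ s ∈ D, E s I ∧ ∀ z ∈ D, (E z s ↔ (E z x ∨ z = x))
  foundation : ∀ x ∈ D, (∃ z ∈ D, E z x) → ∃ m ∈ D, E m x ∧ ∀ z ∈ D, E z m → ¬ E z x
  separation : ∀ φ : Fml, φ.IsPure → ∀ s : ℕ → α, (∀ n, s n ∈ D) → ∀ a ∈ D,
    ∃ b ∈ D, ∀ z ∈ D, E z b ↔
      (E z a ∧ Sat D E ∅ φ (Function.update s 0 z) (fun _ => (∅ : Set α)))
  replacement : ∀ φ : Fml, φ.IsPure → ∀ s : ℕ → α, (∀ n, s n ∈ D) →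
    (∀ x ∈ D, ∀ y ∈ D, ∀ y' ∈ D,
      Sat D E ∅ φ (Function.update (Function.update s 0 x) 1 y) (fun _ => (∅ : Set α)) →
      Sat D E ∅ φ (Function.update (Function.update s 0 x) 1 y') (fun _ => (∅ : Set α)) →
      y = y') →
    ∀ a ∈ D, ∃ b ∈ D, ∀ y ∈ D, E y b ↔ ∃ x ∈ D, E x a ∧
      Sat D E ∅ φ (Function.update (Function.update s 0 x) 1 y) (fun _ => (∅ : Set α))

/-- The Axiom of Choice for sets (choice sets for disjoint families of nonempty sets). -/
def SatAC (D : Set α) (E : α → α → Prop) : Prop :=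
  ∀ x ∈ D, (∀ y ∈ D, E y x → ∃ z ∈ D, E z y) →
    (∀ y ∈ D, ∀ y' ∈ D, E y x → E y' x → (∃ z ∈ D, E z y ∧ E z y') → y = y') →
    ∃ c ∈ D, ∀ y ∈ D, E y x →
      ∃ z ∈ D, E z y ∧ E z c ∧ ∀ w ∈ D, E w y → E w c → w = z

/-- Gödel–Bernays set theory `GB`: ZF for the sets, extensionality for classes
(automatic here since classes are subsets of the first-order part), Class Replacement,
and Elementary Comprehension (for formulas without class quantifiers, allowing
set and class parameters). -/
structure GBModel (D : Set α) (E : α → α → Prop) (𝒳 : Set (Set α)) : Prop where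
  classes_sub : ∀ X ∈ 𝒳, X ⊆ D
  zf : ZFModel D E
  classRepl : ∀ F ∈ 𝒳,
    (∀ x y y', PairIn D E F x y → PairIn D E F x y' → y = y') →
    ∀ a ∈ D, ∃ b ∈ D, ∀ y ∈ D, E y b ↔ ∃ x ∈ D, E x a ∧ PairIn D E F x y
  elemComp : ∀ φ : Fml, φ.IsElementary → ∀ s : ℕ → α, (∀ n, s n ∈ D) →
    ∀ c : ℕ → Set α, (∀ n, c n ∈ 𝒳) →
    ∃ X ∈ 𝒳, ∀ x ∈ D, (x ∈ X ↔ Sat D E 𝒳 φ (Function.update s 0 x) c)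

/-- The Comprehension schema restricted to formulas satisfying `P`
(with set parameters and class parameters from `𝒳`). -/
def Comp (D : Set α) (E : α → α → Prop) (𝒳 : Set (Set α)) (P : Fml → Prop) : Prop :=
  ∀ φ : Fml, P φ → ∀ s : ℕ → α, (∀ n, s n ∈ D) →
    ∀ c : ℕ → Set α, (∀ n, c n ∈ 𝒳) →
    ∃ X ∈ 𝒳, ∀ x ∈ D, (x ∈ X ↔ Sat D E 𝒳 φ (Function.update s 0 x) c)

/-- Kelley–Morse set theory `KM`: `GB` together with full Comprehension for all
second-order formulas. -/
def KMModel (D : Set α) (E : α → α → Prop) (𝒳 : Set (Set α)) : Prop :=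
  GBModel D E 𝒳 ∧ Comp D E 𝒳 (fun _ => True)

/-- Π¹₁-Comprehension. -/
def Pi11CA (D : Set α) (E : α → α → Prop) (𝒳 : Set (Set α)) : Prop :=
  Comp D E 𝒳 Fml.IsPi11

/-- Δ¹₁-Comprehension: if a property of sets is equivalently defined by a Π¹₁ and a
Σ¹₁ formula (with parameters), then the corresponding class exists. -/
def Delta11CA (D : Set α) (E : α → α → Prop) (𝒳 : Set (Set α)) : Prop :=
  ∀ φ ψ : Fml, φ.IsPi11 → ψ.IsSigma11 →
    ∀ s : ℕ → α, (∀ n, s n ∈ D) → ∀ c : ℕ → Set α, (∀ n, c n ∈ 𝒳) →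
    (∀ x ∈ D, Sat D E 𝒳 φ (Function.update s 0 x) c ↔
      Sat D E 𝒳 ψ (Function.update s 0 x) c) →
    ∃ X ∈ 𝒳, ∀ x ∈ D, (x ∈ X ↔ Sat D E 𝒳 φ (Function.update s 0 x) c)

/-- Global Choice: there is a class bijection between the universe `V` and the
class `Ord` of all ordinals. -/
def GlobalChoice (D : Set α) (E : α → α → Prop) (𝒳 : Set (Set α)) : Prop :=
  ∃ F ∈ 𝒳, IsClassRel D E F ∧
    (∀ x y y', PairIn D E F x y → PairIn D E F x y' → y = y') ∧
    (∀ x x' y, PairIn D E F x y → PairIn D E F x' y → x = x') ∧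
    (∀ x ∈ D, ∃ y, PairIn D E F x y ∧ IsOrdIn D E y) ∧
    (∀ y, IsOrdIn D E y → ∃ x ∈ D, PairIn D E F x y)

/-- The `i`-th slice `(C)_i = {y : ⟨i, y⟩ ∈ C}` of a class `C`. -/
def slice (D : Set α) (E : α → α → Prop) (C : Set α) (i : α) : Set α :=
  {y | y ∈ D ∧ PairIn D E C i y}

/-- The restriction `S ↾ r` of a solution class `S` (a class of pairs) to indices
strictly `lt`-below `r`. -/
def sliceRestrict (D : Set α) (E : α → α → Prop) (S : Set α)
    (lt : α → α → Prop) (r : α) : Set α :=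
  {z | z ∈ S ∧ ∃ r' x, lt r' r ∧ IsKPair D E z r' x}

/-- Elementary transfinite recursion along the (external presentation of a) class
relation with field `F` and (transitive) order relation `lt`: for every elementary
formula `φ(x, Y, A)` with class parameter `A ∈ 𝒳` (and set parameters) there is a
solution class `S ∈ 𝒳`, i.e. a class of pairs concentrated on `F` such that for each
`r ∈ F` the slice `S_r` is `{x : φ(x, S ↾ r, A)}`. Class variable `0` is interpreted
by the partial solution `S ↾ r` and the remaining class variables by the parameter. -/
def ETRFor (D : Set α) (E : α → α → Prop) (𝒳 : Set (Set α))
    (F : Set α) (lt : α → α → Prop) : Prop :=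
  ∀ φ : Fml, φ.IsElementary → ∀ A ∈ 𝒳, ∀ s : ℕ → α, (∀ n, s n ∈ D) →
    ∃ S ∈ 𝒳, (∀ z ∈ S, ∃ r x, r ∈ F ∧ x ∈ D ∧ IsKPair D E z r x) ∧
      ∀ r ∈ F, ∀ x ∈ D,
        (PairIn D E S r x ↔
          Sat D E 𝒳 φ (Function.update s 0 x)
            (fun n => if n = 0 then sliceRestrict D E S lt r else A))

/-- The principle `ETR` of Elementary Transfinite Recursion: every elementary recursion
along a class relation in `𝒳` which the model believes to be well-founded has a
solution in `𝒳`. -/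
def ETR (D : Set α) (E : α → α → Prop) (𝒳 : Set (Set α)) : Prop :=
  ∀ R ∈ 𝒳, IsClassRel D E R → IntWF D E R →
    ETRFor D E 𝒳 (relFld D E R) (Relation.TransGen (PairIn D E R))

/-- `x` is internally a natural number: an ordinal all of whose `≤`-elements are zero
or a successor. -/
def IsNatIn (D : Set α) (E : α → α → Prop) (x : α) : Prop :=
  IsOrdIn D E x ∧ ∀ y ∈ D, (E y x ∨ y = x) →
    ((∀ z ∈ D, ¬ E z y) ∨ ∃ z ∈ D, E z y ∧ ∀ w ∈ D, (E w y ↔ (E w z ∨ w = z)))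

/-- The class `Ord` of internal ordinals. -/
def ordsOf (D : Set α) (E : α → α → Prop) : Set α := {x | IsOrdIn D E x}

/-- The class `ω` of internal natural numbers. -/
def natsOf (D : Set α) (E : α → α → Prop) : Set α := {x | IsNatIn D E x}

/-- `ETR_ω`: elementary transfinite recursion along the well-order `ω`. -/
def ETRomega (D : Set α) (E : α → α → Prop) (𝒳 : Set (Set α)) : Prop :=
  ETRFor D E 𝒳 (natsOf D E) E

/-- `ETR_Ord`: elementary transfinite recursion along the well-order `Ord`. -/
def ETROrd (D : Set α) (E : α → α → Prop) (𝒳 : Set (Set α)) : Prop :=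
  ETRFor D E 𝒳 (ordsOf D E) E

/-- `lt` is internally a well-order of the class `F`: irreflexive, transitive, total,
and every nonempty set of elements of `F` has an `lt`-minimal element. -/
def IntWORel (D : Set α) (E : α → α → Prop) (F : Set α) (lt : α → α → Prop) : Prop :=
  (∀ a ∈ F, ¬ lt a a) ∧
  (∀ a ∈ F, ∀ b ∈ F, ∀ c ∈ F, lt a b → lt b c → lt a c) ∧
  (∀ a ∈ F, ∀ b ∈ F, a = b ∨ lt a b ∨ lt b a) ∧
  (∀ d ∈ D, (∃ z ∈ D, E z d) → (∀ z ∈ D, E z d → z ∈ F) →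
    ∃ m ∈ D, E m d ∧ ∀ z ∈ D, E z d → ¬ lt z m)

/-- `W ∈ 𝒳`-style class well-order: a class relation which is internally a well-order
of its field. -/
def IsClassWO (D : Set α) (E : α → α → Prop) (W : Set α) : Prop :=
  IsClassRel D E W ∧ IntWORel D E (relFld D E W) (PairIn D E W)

/-- Strict lexicographic order on `Fin n → ℕ`, most significant coordinate first;
the order type of `(Fin n → ℕ, lex)` is `ω^n`. -/
def FinLexLt {n : ℕ} (v w : Fin n → ℕ) : Prop :=
  ∃ i : Fin n, (∀ j : Fin n, j < i → v j = w j) ∧ v i < w i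

/-- The well-order `(F, lt)` has order type at least `ω^ω`: for each `n` there is an
order embedding of `ω^n` into it. -/
def GeOmegaPowOmega (F : Set α) (lt : α → α → Prop) : Prop :=
  ∀ n : ℕ, ∃ f : (Fin n → ℕ) → α, (∀ v, f v ∈ F) ∧
    ∀ v w, FinLexLt v w → lt (f v) (f w)

/-- The field of the well-order `Γ · ω` (`ω` copies of `Γ`, for `Γ` with field `F`):
internal pairs `⟨n, g⟩` with `n` an internal natural number and `g ∈ F`. -/
def timesOmegaFld (D : Set α) (E : α → α → Prop) (F : Set α) : Set α :=
  {p | ∃ n g, IsNatIn D E n ∧ g ∈ F ∧ IsKPair D E p n g}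

/-- The ordering of `Γ · ω`: pairs `⟨n, g⟩` ordered lexicographically with the
natural-number coordinate most significant. -/
def timesOmegaLt (D : Set α) (E : α → α → Prop) (F : Set α)
    (lt : α → α → Prop) : α → α → Prop :=
  fun p q => ∃ n g m h, IsKPair D E p n g ∧ IsKPair D E q m h ∧
    IsNatIn D E n ∧ IsNatIn D E m ∧ g ∈ F ∧ h ∈ F ∧
    (E n m ∨ (n = m ∧ lt g h))

/-- The classes of `(D, E)` definable by pure first-order formulas with set parameters:
`Def(M)`. -/
def Def0 (D : Set α) (E : α → α → Prop) : Set (Set α) :=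
  {X | ∃ φ : Fml, φ.IsPure ∧ ∃ s : ℕ → α, (∀ n, s n ∈ D) ∧
    X = {x | x ∈ D ∧ Sat D E ∅ φ (Function.update s 0 x) (fun _ => (∅ : Set α))}}

/-- The classes of `(D, E)` definable by elementary formulas with set parameters and the
class parameter `A`: `Def(M; A)`. -/
def DefFrom (D : Set α) (E : α → α → Prop) (A : Set α) : Set (Set α) :=
  {X | ∃ φ : Fml, φ.IsElementary ∧ ∃ s : ℕ → α, (∀ n, s n ∈ D) ∧
    X = {x | x ∈ D ∧ Sat D E {A} φ (Function.update s 0 x) (fun _ => A)}}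

/-- `W` is a global well-order of the model: a class strict linear order of `D` which is
set-like and under which every nonempty set has a least element. -/
def IsGWO (D : Set α) (E : α → α → Prop) (W : Set α) : Prop :=
  IsClassRel D E W ∧
  (∀ a ∈ D, ¬ PairIn D E W a a) ∧
  (∀ a ∈ D, ∀ b ∈ D, ∀ c ∈ D, PairIn D E W a b → PairIn D E W b c → PairIn D E W a c) ∧
  (∀ a ∈ D, ∀ b ∈ D, a = b ∨ PairIn D E W a b ∨ PairIn D E W b a) ∧
  (∀ d ∈ D, (∃ z ∈ D, E z d) →
    ∃ m ∈ D, E m d ∧ ∀ z ∈ D, E z d → ¬ PairIn D E W z m) ∧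
  (∀ a ∈ D, ∃ d ∈ D, ∀ b ∈ D, PairIn D E W b a → E b d)

/-- `(M, 𝒳)` is a transitive model of `GB`: `M` is a transitive set, the membership
relation is the true `∈`, and the classes `𝒳` are subsets of `M`. -/
def TransGB (M : ZFSet) (𝒳 : Set (Set ZFSet)) : Prop :=
  M.IsTransitive ∧ GBModel M.toSet (· ∈ ·) 𝒳

/-- A class relation `R` on a transitive model is *truly* well-founded when the
corresponding external relation is well-founded. -/
def TrulyWF (M : ZFSet) (R : Set ZFSet) : Prop :=
  WellFounded (fun a b : ZFSet => PairIn M.toSet (· ∈ ·) R a b)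

/-- `(M, 𝒳)` is a β-model: every class relation in `𝒳` which the model believes to be
well-founded is truly well-founded. -/
def IsBeta (M : ZFSet) (𝒳 : Set (Set ZFSet)) : Prop :=
  ∀ R ∈ 𝒳, IsClassRel M.toSet (· ∈ ·) R → IntWF M.toSet (· ∈ ·) R → TrulyWF M R

end SOST

namespace SOST

/-- A Gödel code for formulas. -/
def Fml.code : Fml → ℕ
  | .memSS i j => Nat.pair 0 (Nat.pair i j)
  | .memSC i j => Nat.pair 1 (Nat.pair i j)
  | .eqS i j => Nat.pair 2 (Nat.pair i j)
  | .fal => Nat.pair 3 0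
  | .imp φ ψ => Nat.pair 4 (Nat.pair φ.code ψ.code)
  | .allS i φ => Nat.pair 5 (Nat.pair i φ.code)
  | .allC i φ => Nat.pair 6 (Nat.pair i φ.code)

/-- Satisfaction for a second-order theory given as a set `T ⊆ ω` of codes of
(two-sorted) formulas: every coded formula holds under all assignments into the model. -/
def SatSOTheory (D : Set α) (E : α → α → Prop) (𝒳 : Set (Set α)) (T : Set ℕ) : Prop :=
  ∀ φ : Fml, φ.code ∈ T → ∀ s : ℕ → α, (∀ n, s n ∈ D) →
    ∀ c : ℕ → Set α, (∀ n, c n ∈ 𝒳) → Sat D E 𝒳 φ s c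

/-- Satisfaction for a first-order theory given as a set of pure formulas. -/
def SatTheory (D : Set α) (E : α → α → Prop) (T : Set Fml) : Prop :=
  ∀ φ ∈ T, ∀ s : ℕ → α, (∀ n, s n ∈ D) →
    Sat D E ∅ φ s (fun _ => (∅ : Set α))

/-- The internal von Neumann numeral for `k`. -/
def Numeral (D : Set α) (E : α → α → Prop) : ℕ → α → Prop
  | 0, x => x ∈ D ∧ ∀ z ∈ D, ¬ E z x
  | (n + 1), x => x ∈ D ∧ ∃ y ∈ D, Numeral D E n y ∧ ∀ z ∈ D, (E z x ↔ (E z y ∨ z = y))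

/-- The external von Neumann numeral, as a `ZFSet`. -/
def zfNumeral : ℕ → ZFSet
  | 0 => ∅
  | (n + 1) => insert (zfNumeral n) (zfNumeral n)

/-- The real coded by a set `T ⊆ ω` of natural numbers, as a `ZFSet`. -/
def zfCode (T : Set ℕ) : ZFSet :=
  ZFSet.sep (fun z => ∃ k ∈ T, z = zfNumeral k) ZFSet.omega

instance : WellFoundedRelation ZFSet := ⟨_, ZFSet.mem_wf⟩

/-- The subsets of the transitive set `P` (given as a `Set ZFSet`) which are definable
over the structure `(P, ∈)` by a pure first-order formula with parameters from `P`. -/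
def DefSetsOver (P : Set ZFSet) : Set ZFSet :=
  {X | ∃ φ : Fml, φ.IsPure ∧ ∃ s : ℕ → ZFSet, (∀ n, s n ∈ P) ∧
    ∀ z : ZFSet, z ∈ X ↔
      (z ∈ P ∧ Sat P (· ∈ ·) ∅ φ (Function.update s 0 z) (fun _ => (∅ : Set ZFSet)))}

/-- `a` is a genuine von Neumann ordinal (a transitive set of transitive sets). -/
def IsVonNeumann (a : ZFSet) : Prop :=
  a.IsTransitive ∧ ∀ b ∈ a.toSet, b.IsTransitive

/-- The stage `L_a` of the constructible hierarchy, indexed by von Neumann ordinals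
(each stage consists of the subsets definable over the union of the earlier stages). -/
noncomputable def LStage (a : ZFSet) : Set ZFSet :=
  DefSetsOver (⋃ b : {b : ZFSet // b ∈ a}, LStage b.1)
termination_by a
decreasing_by exact b.2

/-- The constructible universe computed inside the transitive set `M`:
the union of the stages `L_α` for `α` an ordinal of `M`. -/
def ConstructibleOf (M : ZFSet) : Set ZFSet :=
  ⋃ a ∈ {a : ZFSet | a ∈ M ∧ IsVonNeumann a}, LStage a

/-- `L^M`, as a transitive subset of `M` (a `ZFSet`). -/
noncomputable def LM (M : ZFSet) : ZFSet :=
  ZFSet.sep (fun x => x ∈ ConstructibleOf M) M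

/-- The collection of all subclasses of (the transitive set) `N` which are amenable
to `N`: `X ∩ a ∈ N` for every `a ∈ N`. -/
def AmenablesOf (N : ZFSet) : Set (Set ZFSet) :=
  {X | X ⊆ N.toSet ∧ ∀ a ∈ N.toSet, ZFSet.sep (fun z => z ∈ X) a ∈ N.toSet}

/-- The binary class relation named by the parameter-free pure formula `θ` (with free
set variables `0` and `1`), evaluated in the model `(D, E)`. -/
def NameRel (θ : Fml) (D : Set α) (E : α → α → Prop) (x y : α) : Prop :=
  x ∈ D ∧ y ∈ D ∧ ∀ s : ℕ → α, (∀ n, s n ∈ D) →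
    Sat D E ∅ θ (Function.update (Function.update s 0 x) 1 y) (fun _ => (∅ : Set α))

/-- The field of the class relation named by `θ` in the model `(D, E)`. -/
def NameFld (θ : Fml) (D : Set α) (E : α → α → Prop) : Set α :=
  {x | ∃ y, NameRel θ D E x y ∨ NameRel θ D E y x}

/-- The set named by the parameter-free pure formula `θ` (with free set variable `0`),
evaluated in the model `(D, E)`. -/
def NameSet (θ : Fml) (D : Set α) (E : α → α → Prop) (x : α) : Prop :=
  x ∈ D ∧ ∀ s : ℕ → α, (∀ n, s n ∈ D) →
    Sat D E ∅ θ (Function.update s 0 x) (fun _ => (∅ : Set α))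

/-- `𝒴` is coded in the model by the single class `C`: the members of `𝒴` are exactly
the classes definable (by elementary formulas, with set parameters) from finitely many
slices of `C`. -/
def CodedBy (D : Set α) (E : α → α → Prop) (C : Set α) (𝒴 : Set (Set α)) : Prop :=
  ∀ X : Set α, X ∈ 𝒴 ↔
    ∃ φ : Fml, φ.IsElementary ∧ ∃ s : ℕ → α, (∀ n, s n ∈ D) ∧
      ∃ g : ℕ → α, (∀ n, g n ∈ D) ∧
      X = {x | x ∈ D ∧ Sat D E 𝒴 φ (Function.update s 0 x)
        (fun n => slice D E C (g n))}

end SOST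

namespace SOST

/-- Δ₀ (bounded) formulas of the first-order language of set theory: all quantifiers
appear in the bounded pattern `∀ xᵢ (xᵢ ∈ xⱼ → …)`. -/
def Fml.IsDelta0 : Fml → Prop
  | .memSS _ _ => True
  | .memSC _ _ => False
  | .eqS _ _ => True
  | .fal => True
  | .imp φ ψ => φ.IsDelta0 ∧ ψ.IsDelta0
  | .allS i (.imp (.memSS i' j) φ) => i = i' ∧ i ≠ j ∧ φ.IsDelta0
  | .allS _ _ => False
  | .allC _ _ => False

/-- Π₁ formulas: a block of universal set quantifiers followed by a Δ₀ formula. -/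
def Fml.IsPi1 : Fml → Prop
  | .allS _ φ => φ.IsPi1
  | φ => φ.IsDelta0

/-- Kripke–Platek set theory `KP` over the structure with domain `D` and membership `E`:
Extensionality, Pairing, Union, Δ₀-Separation, Δ₀-Collection, and Π₁-Foundation. -/
structure KPModel (D : Set α) (E : α → α → Prop) : Prop where
  exten : ∀ x ∈ D, ∀ y ∈ D, (∀ z ∈ D, E z x ↔ E z y) → x = y
  pairing : ∀ x ∈ D, ∀ y ∈ D, ∃ p ∈ D, ∀ z ∈ D, E z p ↔ (z = x ∨ z = y)
  union : ∀ x ∈ D, ∃ u ∈ D, ∀ z ∈ D, E z u ↔ ∃ w ∈ D, E w x ∧ E z w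
  delta0Sep : ∀ φ : Fml, φ.IsDelta0 → ∀ s : ℕ → α, (∀ n, s n ∈ D) → ∀ a ∈ D,
    ∃ b ∈ D, ∀ z ∈ D, E z b ↔
      (E z a ∧ Sat D E ∅ φ (Function.update s 0 z) (fun _ => (∅ : Set α)))
  delta0Coll : ∀ φ : Fml, φ.IsDelta0 → ∀ s : ℕ → α, (∀ n, s n ∈ D) → ∀ a ∈ D,
    (∀ x ∈ D, E x a → ∃ y ∈ D,
      Sat D E ∅ φ (Function.update (Function.update s 0 x) 1 y) (fun _ => (∅ : Set α))) →
    ∃ b ∈ D, ∀ x ∈ D, E x a → ∃ y ∈ D, E y b ∧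
      Sat D E ∅ φ (Function.update (Function.update s 0 x) 1 y) (fun _ => (∅ : Set α))
  pi1Foundation : ∀ φ : Fml, φ.IsPi1 → ∀ s : ℕ → α, (∀ n, s n ∈ D) →
    (∃ x ∈ D, Sat D E ∅ φ (Function.update s 0 x) (fun _ => (∅ : Set α))) →
    ∃ x ∈ D, Sat D E ∅ φ (Function.update s 0 x) (fun _ => (∅ : Set α)) ∧
      ∀ y ∈ D, E y x → ¬ Sat D E ∅ φ (Function.update s 0 y) (fun _ => (∅ : Set α))

/-- `m` is the maximum element of the class relation `N`: every other element of the
field lies below `m` in the transitive closure of `N`. -/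
def IsMaxOf (D : Set α) (E : α → α → Prop) (N : Set α) (m : α) : Prop :=
  m ∈ relFld D E N ∧
    ∀ a ∈ relFld D E N, a ≠ m → Relation.TransGen (PairIn D E N) a m

/-- A *membership code*: a well-founded (in the sense of the model), extensional class
binary relation with a maximum element. -/
def IsMemCode (D : Set α) (E : α → α → Prop) (N : Set α) : Prop :=
  IsClassRel D E N ∧ IntWF D E N ∧
    (∀ a ∈ relFld D E N, ∀ b ∈ relFld D E N,
      (∀ c, PairIn D E N c a ↔ PairIn D E N c b) → a = b) ∧
    ∃ m, IsMaxOf D E N m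

/-- The membership code `(N, m)` codes a transitive set: predecessors of predecessors
of the maximum element are predecessors of the maximum element. -/
def CodesTransitiveSet (D : Set α) (E : α → α → Prop) (N : Set α) (m : α) : Prop :=
  ∀ a b, PairIn D E N a b → PairIn D E N b m → PairIn D E N a m

/-- The set coded by `(N, m)` contains (an isomorphic copy of) the class `V` of all
sets as an element: there are `v` below `m` and a class isomorphism `I ∈ 𝒳` between
`(D, E)` and the predecessors of `v` in `N`. -/
def ContainsUniverse (D : Set α) (E : α → α → Prop) (𝒳 : Set (Set α))
    (N : Set α) (m : α) : Prop :=
  ∃ v, PairIn D E N v m ∧ ∃ I ∈ 𝒳,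
    (∀ z ∈ I, ∃ x a, x ∈ D ∧ IsKPair D E z x a) ∧
    (∀ x a a', PairIn D E I x a → PairIn D E I x a' → a = a') ∧
    (∀ x x' a, PairIn D E I x a → PairIn D E I x' a → x = x') ∧
    (∀ x ∈ D, ∃ a, PairIn D E I x a ∧ PairIn D E N a v) ∧
    (∀ a, PairIn D E N a v → ∃ x ∈ D, PairIn D E I x a) ∧
    (∀ x y a b, PairIn D E I x a → PairIn D E I y b → (E x y ↔ PairIn D E N a b))

/-- `N` is a membership code for (a transitive model of) `Hyp(V)`-style structure:
it codes a transitive model of `KP` containing the universe as an element. -/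
def IsHypVCode (D : Set α) (E : α → α → Prop) (𝒳 : Set (Set α)) (N : Set α) : Prop :=
  IsMemCode D E N ∧ ∃ m, IsMaxOf D E N m ∧ CodesTransitiveSet D E N m ∧
    KPModel {a | PairIn D E N a m} (PairIn D E N) ∧
    ContainsUniverse D E 𝒳 N m

/-- `J` is (the graph of) an isomorphism of the membership code `N₀` onto an initial
(downward closed) part of the membership code `N`. -/
def InitEmbed (D : Set α) (E : α → α → Prop) (N₀ N J : Set α) : Prop :=
  (∀ z ∈ J, ∃ a b, IsKPair D E z a b) ∧
  (∀ a b b', PairIn D E J a b → PairIn D E J a b' → b = b') ∧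
  (∀ a a' b, PairIn D E J a b → PairIn D E J a' b → a = a') ∧
  (∀ a b, PairIn D E J a b → a ∈ relFld D E N₀ ∧ b ∈ relFld D E N) ∧
  (∀ a ∈ relFld D E N₀, ∃ b, PairIn D E J a b) ∧
  (∀ a a' b b', PairIn D E J a b → PairIn D E J a' b' →
    (PairIn D E N₀ a a' ↔ PairIn D E N b b')) ∧
  (∀ a b c, PairIn D E J a b → PairIn D E N c b →
    ∃ a', PairIn D E N₀ a' a ∧ PairIn D E J a' c)

/-! ### Kripke–Platek set theory with urelements, and `Hyp(M)` -/

/-- Formulas of the language of `KPU` over a structure `M`: membership `mem`, equality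
`eq`, the urelement predicate `urel`, and the membership relation `memU` of `M` on the
urelements. -/
inductive UFml : Type
  | mem : ℕ → ℕ → UFml
  | eq : ℕ → ℕ → UFml
  | urel : ℕ → UFml
  | memU : ℕ → ℕ → UFml
  | fal : UFml
  | imp : UFml → UFml → UFml
  | all : ℕ → UFml → UFml

variable {β : Type*}

/-- Satisfaction for `UFml` in a structure `(β, u, Eb, EU)`: `u` is the urelement
predicate, `Eb` the set membership and `EU` the membership relation of `M` on the
urelements. -/
def USat (u : β → Prop) (Eb EU : β → β → Prop) : UFml → (ℕ → β) → Prop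
  | .mem i j, s => Eb (s i) (s j)
  | .eq i j, s => s i = s j
  | .urel i, s => u (s i)
  | .memU i j, s => EU (s i) (s j)
  | .fal, _ => False
  | .imp φ ψ, s => USat u Eb EU φ s → USat u Eb EU ψ s
  | .all i φ, s => ∀ x : β, USat u Eb EU φ (Function.update s i x)

/-- Δ₀ formulas of the language of `KPU`. -/
def UFml.IsDelta0 : UFml → Prop
  | .mem _ _ => True
  | .eq _ _ => True
  | .urel _ => True
  | .memU _ _ => True
  | .fal => True
  | .imp φ ψ => φ.IsDelta0 ∧ ψ.IsDelta0
  | .all i (.imp (.mem i' j) φ) => i = i' ∧ i ≠ j ∧ φ.IsDelta0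
  | .all _ _ => False

/-- Kripke–Platek set theory with urelements, `KPU`: extensionality for sets, urelements
have no members, Pairing, Union, Δ₀-Separation, Δ₀-Collection, and the Foundation
schema. -/
structure KPUModel (u : β → Prop) (Eb EU : β → β → Prop) : Prop where
  urelNoMem : ∀ x, u x → ∀ z, ¬ Eb z x
  euUrel : ∀ x y, EU x y → u x ∧ u y
  exten : ∀ x y, ¬ u x → ¬ u y → (∀ z, Eb z x ↔ Eb z y) → x = y
  pairing : ∀ x y, ∃ p, ¬ u p ∧ ∀ z, Eb z p ↔ (z = x ∨ z = y)
  union : ∀ x, ∃ w, ¬ u w ∧ ∀ z, Eb z w ↔ ∃ y, Eb y x ∧ Eb z y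
  delta0Sep : ∀ φ : UFml, φ.IsDelta0 → ∀ s : ℕ → β, ∀ a,
    ∃ b, ¬ u b ∧ ∀ z, Eb z b ↔ (Eb z a ∧ USat u Eb EU φ (Function.update s 0 z))
  delta0Coll : ∀ φ : UFml, φ.IsDelta0 → ∀ s : ℕ → β, ∀ a,
    (∀ x, Eb x a → ∃ y, USat u Eb EU φ (Function.update (Function.update s 0 x) 1 y)) →
    ∃ b, ∀ x, Eb x a → ∃ y, Eb y b ∧
      USat u Eb EU φ (Function.update (Function.update s 0 x) 1 y)
  foundation : ∀ φ : UFml, ∀ s : ℕ → β,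
    (∃ x, USat u Eb EU φ (Function.update s 0 x)) →
    ∃ x, USat u Eb EU φ (Function.update s 0 x) ∧
      ∀ y, Eb y x → ¬ USat u Eb EU φ (Function.update s 0 y)

/-- The structure `(β, u, Eb, EU)` is a model of `KPU` over the first-order model of set
theory `(α, E)`, with the urelements forming an isomorphic copy of `(α, E)` (via `ι`)
and with the set of all urelements (i.e., `M` itself) existing as an element. -/
def IsKPUOver (E : α → α → Prop) (u : β → Prop) (Eb EU : β → β → Prop)
    (ι : α → β) : Prop :=
  KPUModel u Eb EU ∧
  Function.Injective ι ∧
  (∀ x, u (ι x)) ∧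
  (∀ b, u b → ∃ x, b = ι x) ∧
  (∀ x y, EU (ι x) (ι y) ↔ E x y) ∧
  (∃ m, ¬ u m ∧ ∀ z, Eb z m ↔ u z)

/-- `S ⊆ M` is internal to the `KPU` structure: some element `b` has exactly the
urelements corresponding to `S` as its members. -/
def InternalIn (u : β → Prop) (Eb : β → β → Prop) (ι : α → β) (S : Set α) : Prop :=
  ∃ b, ¬ u b ∧ (∀ z, Eb z b → u z) ∧ ∀ x, (Eb (ι x) b ↔ x ∈ S)

/-- `Hyp(M) ∩ 𝒫(M)`: the collection of all `S ⊆ M` which are internal to every model of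
`KPU` over `M` containing `M` as an element. (For countable `M` this is exactly the
collection of subsets of `M` lying in the least admissible set `Hyp(M)` above `M`.) -/
def HypClasses {α : Type} (E : α → α → Prop) : Set (Set α) :=
  {S | ∀ (β : Type) (u : β → Prop) (Eb EU : β → β → Prop) (ι : α → β),
    IsKPUOver E u Eb EU ι → InternalIn u Eb ι S}

end SOST

namespace SOST

variable {α : Type*}

/-- `GBC`: Gödel–Bernays set theory with Global Choice. -/
def GBC (D : Set α) (E : α → α → Prop) (𝒳 : Set (Set α)) : Prop :=
  GBModel D E 𝒳 ∧ GlobalChoice D E 𝒳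

/-- The Class Collection schema: if for every set `x` there is a class `Y` with
`φ(x, Y, P̄)`, then there is a single class `C` such that for every `x` some slice
`(C)_i` witnesses `φ`. -/
def ClassCollection (D : Set α) (E : α → α → Prop) (𝒳 : Set (Set α)) : Prop :=
  ∀ φ : Fml, ∀ s : ℕ → α, (∀ n, s n ∈ D) → ∀ c : ℕ → Set α, (∀ n, c n ∈ 𝒳) →
    (∀ x ∈ D, ∃ Y ∈ 𝒳,
      Sat D E 𝒳 φ (Function.update s 0 x) (Function.update c 0 Y)) →
    ∃ C ∈ 𝒳, ∀ x ∈ D, ∃ i ∈ D,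
      Sat D E 𝒳 φ (Function.update s 0 x) (Function.update c 0 (slice D E C i))

/-- The Class Choice schema: as Class Collection, but the witnessing slice for `x`
is `(C)_x` itself. -/
def ClassChoice (D : Set α) (E : α → α → Prop) (𝒳 : Set (Set α)) : Prop :=
  ∀ φ : Fml, ∀ s : ℕ → α, (∀ n, s n ∈ D) → ∀ c : ℕ → Set α, (∀ n, c n ∈ 𝒳) →
    (∀ x ∈ D, ∃ Y ∈ 𝒳,
      Sat D E 𝒳 φ (Function.update s 0 x) (Function.update c 0 Y)) →
    ∃ C ∈ 𝒳, ∀ x ∈ D,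
      Sat D E 𝒳 φ (Function.update s 0 x) (Function.update c 0 (slice D E C x))

/-- `x` is internally the empty set (the numeral `0`). -/
def IsZeroIn (D : Set α) (E : α → α → Prop) (x : α) : Prop :=
  x ∈ D ∧ ∀ z ∈ D, ¬ E z x

/-- `x` is internally the numeral `1 = {0}`. -/
def IsOneIn (D : Set α) (E : α → α → Prop) (x : α) : Prop :=
  x ∈ D ∧ ∀ z ∈ D, (E z x ↔ IsZeroIn D E z)

/-- The pair `⟨a, b⟩` is an element of the *set* `p`. -/
def pairInSet (D : Set α) (E : α → α → Prop) (p a b : α) : Prop :=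
  ∃ z ∈ D, E z p ∧ IsKPair D E z a b

/-- `p` is a condition of the class forcing to add a Cohen subclass of `Ord`:
a set-sized binary sequence, i.e. an internal function from some ordinal to `2`. -/
def IsCond (D : Set α) (E : α → α → Prop) (p : α) : Prop :=
  p ∈ D ∧ ∃ γ, IsOrdIn D E γ ∧
    (∀ z ∈ D, E z p → ∃ ξ v, E ξ γ ∧ (IsZeroIn D E v ∨ IsOneIn D E v) ∧
      IsKPair D E z ξ v) ∧
    (∀ ξ ∈ D, E ξ γ → ∃ v, pairInSet D E p ξ v) ∧
    (∀ ξ v v', pairInSet D E p ξ v → pairInSet D E p ξ v' → v = v')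

/-- `q` extends the condition `p` (is a stronger condition). -/
def CondExtends (D : Set α) (E : α → α → Prop) (q p : α) : Prop :=
  ∀ ξ v, pairInSet D E p ξ v → pairInSet D E q ξ v

/-- The condition `p` agrees with the class `C ⊆ Ord` (is an initial segment of its
characteristic function). -/
def AgreesWith (D : Set α) (E : α → α → Prop) (C : Set α) (p : α) : Prop :=
  ∀ ξ v, pairInSet D E p ξ v → ((ξ ∈ C) ↔ IsOneIn D E v)

/-- `C ⊆ Ord` is a Cohen-generic class over the model: it is a class of ordinals
decided below every ordinal by a condition, and it meets every dense class of
conditions definable over the model from set parameters. -/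
def CohenGeneric (D : Set α) (E : α → α → Prop) (C : Set α) : Prop :=
  (∀ x ∈ C, IsOrdIn D E x) ∧
  (∀ γ, IsOrdIn D E γ → ∃ p, IsCond D E p ∧ AgreesWith D E C p ∧
    ∀ ξ ∈ D, E ξ γ → ∃ v, pairInSet D E p ξ v) ∧
  (∀ Δ ∈ Def0 D E, (∀ z ∈ Δ, IsCond D E z) →
    (∀ p, IsCond D E p → ∃ q ∈ Δ, CondExtends D E q p) →
    ∃ p ∈ Δ, AgreesWith D E C p)

/-- `𝒳` is a β-`(GB + ETR)`-realization for the transitive set `M`. -/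
def BetaETRReal (M : ZFSet) (𝒳 : Set (Set ZFSet)) : Prop :=
  GBModel M.toSet (· ∈ ·) 𝒳 ∧ ETR M.toSet (· ∈ ·) 𝒳 ∧ IsBeta M 𝒳

/-- `(D, E, 𝒳)` is (isomorphic to) a β-model: the membership relation is well-founded
and extensional (so the model is isomorphic to a transitive one), and every class
relation in `𝒳` believed to be well-founded is truly well-founded. -/
def BetaReal (D : Set α) (E : α → α → Prop) (𝒳 : Set (Set α)) : Prop :=
  WellFounded (fun x y => x ∈ D ∧ y ∈ D ∧ E x y) ∧
  (∀ x ∈ D, ∀ y ∈ D, (∀ z ∈ D, E z x ↔ E z y) → x = y) ∧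
  ∀ R ∈ 𝒳, IsClassRel D E R → IntWF D E R →
    WellFounded (fun a b => PairIn D E R a b)

end SOST


namespace SOST

set_option hygiene false in
local notation "auto_dfn" => by repeat' first | assumption | refine Dfn1.mk ?_ | refine Dfn2.mk ?_ | refine Dfn3.mk ?_ | refine DfnF1.mk ?_ | refine DfnF2.mk ?_ | exact DfnF.var _ | exact DfnF.const _ | with_reducible apply Dfn.not | with_reducible apply Dfn.iff | with_reducible apply Dfn.and | with_reducible apply Dfn.or | with_reducible apply Dfn.eq | with_reducible apply Dfn.mem | with_reducible exact Dfn.const _ | with_reducible apply Dfn.comp3 | with_reducible apply Dfn.comp2 | with_reducible apply Dfn.comp1 | with_reducible apply DfnF.comp2 | with_reducible apply DfnF.comp1 | with_reducible apply Dfn.imp | refine Dfn.ex ?_ | refine Dfn.all ?_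

section Definability

variable {α : Type} {E : α → α → Prop} {𝒳 : Set (Set α)}

/-- Truth of a formula without class quantifiers, with the carrier as domain of the set quantifiers. -/
abbrev Tr (E : α → α → Prop) (φ : Fml) (s : ℕ → α) (c : ℕ → Set α) : Prop :=
  Sat Set.univ E ∅ φ s c

theorem sat_elementary_iff {D : Set α} {𝒳' : Set (Set α)} {φ : Fml} (hφ : φ.IsElementary)
    (s : ℕ → α) (c : ℕ → Set α) : Sat D E 𝒳 φ s c ↔ Sat D E 𝒳' φ s c := by
  induction φ generalizing s with
  | imp φ ψ ih₁ ih₂ => simp only [Sat, ih₁ hφ.1, ih₂ hφ.2]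
  | allS i φ ih => simp only [Sat, ih hφ]
  | allC i φ ih => exact hφ.elim
  | _ => rfl

/-- Rename the set variables along `f` and the class variables along `g`. -/
def Fml.rename (f g : ℕ → ℕ) : Fml → Fml
  | .memSS i j => .memSS (f i) (f j)
  | .memSC i j => .memSC (f i) (g j)
  | .eqS i j => .eqS (f i) (f j)
  | .fal => .fal
  | .imp φ ψ => .imp (φ.rename f g) (ψ.rename f g)
  | .allS i φ => .allS (f i) (φ.rename f g)
  | .allC i φ => .allC (g i) (φ.rename f g)

theorem Fml.IsElementary.rename {φ : Fml} (h : φ.IsElementary) (f g : ℕ → ℕ) :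
    (φ.rename f g).IsElementary := by
  induction φ with
  | imp φ ψ ih₁ ih₂ => exact ⟨ih₁ h.1, ih₂ h.2⟩
  | allS i φ ih => exact ih h
  | allC i φ ih => exact h.elim
  | _ => trivial

theorem tr_rename {f : ℕ → ℕ} (hf : Function.Injective f) (g : ℕ → ℕ) {φ : Fml}
    (h : φ.IsElementary) (s : ℕ → α) (c : ℕ → Set α) :
    Tr E (φ.rename f g) s c ↔ Tr E φ (fun n => s (f n)) (fun n => c (g n)) := by
  induction φ generalizing s with
  | imp φ ψ ih₁ ih₂ =>
    simp only [Tr, Fml.rename, Sat] at *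
    rw [ih₁ h.1, ih₂ h.2]
  | allS i φ ih =>
    simp only [Tr, Fml.rename, Sat] at *
    refine forall₂_congr fun x _ => ?_
    rw [ih h]
    have : (fun n => Function.update s (f i) x (f n)) = Function.update (fun n => s (f n)) i x :=
      Function.update_comp_eq_of_injective s hf i x
    rw [this]
  | allC i φ ih => exact h.elim
  | _ => rfl

/-- Classes of parameters containing all singletons. -/
class Params (𝒳 : Set (Set α)) : Prop where
  nonempty : Nonempty α
  sing : ∀ a, {a} ∈ 𝒳

theorem Params.mono {𝒳' : Set (Set α)} [hp : Params 𝒳] (h : 𝒳 ⊆ 𝒳') : Params 𝒳' :=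
  ⟨hp.nonempty, fun a => h (hp.sing a)⟩

variable (E 𝒳) in
/-- `P` is definable by a formula without class quantifiers, with class parameters from `𝒳`. -/
structure Dfn (P : (ℕ → α) → Prop) : Prop where
  out : ∃ φ : Fml, φ.IsElementary ∧ ∃ c : ℕ → Set α, (∀ n, c n ∈ 𝒳) ∧ ∀ s, P s ↔ Tr E φ s c

variable (E 𝒳) in
/-- Definable unary predicates. -/
structure Dfn1 (P : α → Prop) : Prop where
  out : Dfn E 𝒳 fun s => P (s 0)

variable (E 𝒳) in
/-- Definable binary predicates. -/
structure Dfn2 (P : α → α → Prop) : Prop where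
  out : Dfn E 𝒳 fun s => P (s 0) (s 1)

variable (E 𝒳) in
/-- Definable ternary predicates. -/
structure Dfn3 (P : α → α → α → Prop) : Prop where
  out : Dfn E 𝒳 fun s => P (s 0) (s 1) (s 2)

variable (E 𝒳) in
/-- Definable functions of an assignment. -/
structure DfnF (f : (ℕ → α) → α) : Prop where
  out : Dfn E 𝒳 fun s => s 0 = f fun n => s (n + 1)

variable (E 𝒳) in
/-- Definable unary functions. -/
structure DfnF1 (f : α → α) : Prop where
  out : DfnF E 𝒳 fun s => f (s 0)

variable (E 𝒳) in
/-- Definable binary functions. -/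
structure DfnF2 (f : α → α → α) : Prop where
  out : DfnF E 𝒳 fun s => f (s 0) (s 1)

theorem Dfn.congr {P Q : (ℕ → α) → Prop} (h : Dfn E 𝒳 P) (e : ∀ s, Q s ↔ P s) : Dfn E 𝒳 Q := by
  rwa [show Q = P from funext fun s => propext (e s)]

theorem Dfn.mono {𝒳' : Set (Set α)} {P : (ℕ → α) → Prop} (h : Dfn E 𝒳 P) (hs : 𝒳 ⊆ 𝒳') :
    Dfn E 𝒳' P := by
  obtain ⟨φ, e, c, hc, h⟩ := h.out
  exact ⟨φ, e, c, fun n => hs (hc n), h⟩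

theorem Dfn.imp {P Q : (ℕ → α) → Prop} (hP : Dfn E 𝒳 P) (hQ : Dfn E 𝒳 Q) :
    Dfn E 𝒳 fun s => P s → Q s := by
  obtain ⟨φ, e, c, hc, h⟩ := hP.out
  obtain ⟨ψ, e', c', hc', h'⟩ := hQ.out
  refine ⟨.imp (φ.rename id fun n => 2 * n) (ψ.rename id fun n => 2 * n + 1),
    ⟨e.rename _ _, e'.rename _ _⟩, fun n => if n % 2 = 0 then c (n / 2) else c' (n / 2), ?_, ?_⟩
  · intro n
    dsimp only
    split_ifs
    exacts [hc _, hc' _]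
  · intro s
    have h1 := tr_rename (E := E) Function.injective_id (fun n => 2 * n) e s
      fun n => if n % 2 = 0 then c (n / 2) else c' (n / 2)
    have h2 := tr_rename (E := E) Function.injective_id (fun n => 2 * n + 1) e' s
      fun n => if n % 2 = 0 then c (n / 2) else c' (n / 2)
    have e1 : (fun n => if 2 * n % 2 = 0 then c (2 * n / 2) else c' (2 * n / 2)) = c := by
      funext n; simp
    have e2 : (fun n => if (2 * n + 1) % 2 = 0 then c ((2 * n + 1) / 2)
        else c' ((2 * n + 1) / 2)) = c' := by
      funext n
      have : (2 * n + 1) / 2 = n := by omega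
      simp [this]
    rw [e1] at h1
    rw [e2] at h2
    simp only [Tr, Sat, id] at *
    rw [h1, h2, h, h']

theorem Dfn.updAll {P : (ℕ → α) → Prop} (i : ℕ) (hP : Dfn E 𝒳 P) :
    Dfn E 𝒳 fun s => ∀ x, P (Function.update s i x) := by
  obtain ⟨φ, e, c, hc, h⟩ := hP.out
  exact ⟨.allS i φ, e, c, hc, fun s => by simp [Tr, Sat, h]⟩

theorem Dfn.rename {P : (ℕ → α) → Prop} {f : ℕ → ℕ} (hf : Function.Injective f)
    (hP : Dfn E 𝒳 P) : Dfn E 𝒳 fun s => P fun n => s (f n) := by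
  obtain ⟨φ, e, c, hc, h⟩ := hP.out
  exact ⟨φ.rename f id, e.rename _ _, c, hc, fun s => by
    rw [h]; exact (tr_rename hf id e s c).symm⟩

theorem tr_support {φ : Fml} (e : φ.IsElementary) : ∃ K : ℕ, ∀ (E : α → α → Prop)
    (s s' : ℕ → α) (c c' : ℕ → Set α), (∀ i < K, s i = s' i) → (∀ i < K, c i = c' i) →
      (Tr E φ s c ↔ Tr E φ s' c') := by
  induction φ with
  | memSS i j =>
    refine ⟨i + j + 1, fun E s s' c c' h _ => ?_⟩
    simp only [Tr, Sat]; rw [h i (by omega), h j (by omega)]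
  | memSC i j =>
    refine ⟨i + j + 1, fun E s s' c c' h h' => ?_⟩
    simp only [Tr, Sat]; rw [h i (by omega), h' j (by omega)]
  | eqS i j =>
    refine ⟨i + j + 1, fun E s s' c c' h _ => ?_⟩
    simp only [Tr, Sat]; rw [h i (by omega), h j (by omega)]
  | fal => exact ⟨0, fun E s s' c c' _ _ => Iff.rfl⟩
  | imp φ ψ ih₁ ih₂ =>
    obtain ⟨K, hK⟩ := ih₁ e.1
    obtain ⟨L, hL⟩ := ih₂ e.2
    refine ⟨K + L, fun E s s' c c' h h' => ?_⟩
    have h1 := hK E s s' c c' (fun i hi => h i (by omega)) fun i hi => h' i (by omega)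
    have h2 := hL E s s' c c' (fun i hi => h i (by omega)) fun i hi => h' i (by omega)
    simp only [Tr, Sat] at *
    rw [h1, h2]
  | allS i φ ih =>
    obtain ⟨K, hK⟩ := ih e
    refine ⟨K, fun E s s' c c' h h' => ?_⟩
    simp only [Tr, Sat]
    refine forall₂_congr fun x _ => hK E _ _ c c' (fun j hj => ?_) h'
    by_cases hji : j = i
    · subst hji; simp
    · simp [hji, h j hj]
  | allC i φ ih => exact e.elim

theorem Dfn.support {P : (ℕ → α) → Prop} (hP : Dfn E 𝒳 P) :
    ∃ K : ℕ, ∀ s s' : ℕ → α, (∀ i < K, s i = s' i) → (P s ↔ P s') := by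
  obtain ⟨φ, e, c, hc, h⟩ := hP.out
  obtain ⟨K, hK⟩ := tr_support (α := α) e
  exact ⟨K, fun s s' hs => by rw [h, h]; exact hK E s s' c c hs fun _ _ => rfl⟩

theorem Dfn.classVar (i : ℕ) {X : Set α} (hX : X ∈ 𝒳) : Dfn E 𝒳 fun s => s i ∈ X :=
  ⟨.memSC i 0, trivial, fun _ => X, fun _ => hX, fun _ => Iff.rfl⟩

theorem Dfn.all {P : α → (ℕ → α) → Prop} (hP : Dfn E 𝒳 fun s => P (s 0) fun n => s (n + 1)) :
    Dfn E 𝒳 fun s => ∀ x, P x s := by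
  obtain ⟨K, hK⟩ := hP.support
  let f : ℕ → ℕ := fun n => if n = 0 then K else if n ≤ K then n - 1 else n
  have hf : Function.Injective f := by
    intro a b hab
    simp only [f] at hab
    split_ifs at hab <;> omega
  refine ((hP.rename hf).updAll K).congr fun s => forall_congr' fun x => ?_
  have := hK (fun n => Nat.casesOn n x s) (fun n => Function.update s K x (f n)) (by
    intro i hi
    rcases i with _ | i
    · simp [f]
    · have : f (i + 1) = i := by simp [f]; omega
      rw [this, Function.update_of_ne (by omega)])
  simpa using this

theorem DfnF.shift {f : (ℕ → α) → α} (hf : DfnF E 𝒳 f) : DfnF E 𝒳 fun s => f fun n => s (n + 1) := by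
  have := hf.out.rename (f := fun n => if n = 0 then 0 else n + 1)
    (by intro a b h; dsimp only at h; split_ifs at h <;> omega)
  exact ⟨this.congr fun s => by simp⟩

theorem Dfn1.of_mem {X : Set α} (hX : X ∈ 𝒳) : Dfn1 E 𝒳 fun x => x ∈ X :=
  ⟨.classVar 0 hX⟩

variable [hpar : Params 𝒳]

theorem Params.some_mem (𝒳 : Set (Set α)) [hpar : Params 𝒳] : ∃ X, X ∈ 𝒳 := by
  obtain ⟨a⟩ := hpar.nonempty
  exact ⟨_, hpar.sing a⟩

theorem Dfn.false : Dfn E 𝒳 fun _ => False := by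
  obtain ⟨X, hX⟩ := Params.some_mem 𝒳
  exact ⟨.fal, trivial, fun _ => X, fun _ => hX, fun _ => Iff.rfl⟩

theorem Dfn.memVar (i j : ℕ) : Dfn E 𝒳 fun s => E (s i) (s j) := by
  obtain ⟨X, hX⟩ := Params.some_mem 𝒳
  exact ⟨.memSS i j, trivial, fun _ => X, fun _ => hX, fun _ => Iff.rfl⟩

theorem Dfn.eqVar (i j : ℕ) : Dfn E 𝒳 fun s => s i = s j := by
  obtain ⟨X, hX⟩ := Params.some_mem 𝒳
  exact ⟨.eqS i j, trivial, fun _ => X, fun _ => hX, fun _ => Iff.rfl⟩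

theorem Dfn.not {P : (ℕ → α) → Prop} (hP : Dfn E 𝒳 P) : Dfn E 𝒳 fun s => ¬ P s :=
  hP.imp .false

theorem Dfn.const (p : Prop) : Dfn E 𝒳 fun _ => p := by
  by_cases h : p
  · exact (Dfn.false.imp .false).congr fun s => by simp [h]
  · exact Dfn.false.congr fun s => by simp [h]

theorem Dfn.or {P Q : (ℕ → α) → Prop} (hP : Dfn E 𝒳 P) (hQ : Dfn E 𝒳 Q) :
    Dfn E 𝒳 fun s => P s ∨ Q s :=
  (hP.not.imp hQ).congr fun s => by tauto

theorem Dfn.and {P Q : (ℕ → α) → Prop} (hP : Dfn E 𝒳 P) (hQ : Dfn E 𝒳 Q) :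
    Dfn E 𝒳 fun s => P s ∧ Q s :=
  (hP.imp hQ.not).not.congr fun s => by tauto

theorem Dfn.iff {P Q : (ℕ → α) → Prop} (hP : Dfn E 𝒳 P) (hQ : Dfn E 𝒳 Q) :
    Dfn E 𝒳 fun s => P s ↔ Q s :=
  ((hP.imp hQ).and (hQ.imp hP)).congr fun s => by tauto

theorem Dfn.ex {P : α → (ℕ → α) → Prop} (hP : Dfn E 𝒳 fun s => P (s 0) fun n => s (n + 1)) :
    Dfn E 𝒳 fun s => ∃ x, P x s :=
  (Dfn.all (P := fun x s => ¬ P x s) hP.not).not.congr fun s => by push Not; rfl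

theorem DfnF.var (i : ℕ) : DfnF E 𝒳 fun s => s i := ⟨.eqVar 0 (i + 1)⟩

theorem DfnF.const (a : α) : DfnF E 𝒳 fun _ => a :=
  ⟨(Dfn.classVar 0 (hpar.sing a)).congr fun s => by simp⟩

theorem Dfn.comp {P : (ℕ → α) → Prop} (hP : Dfn E 𝒳 P) {f : ℕ → (ℕ → α) → α}
    (hf : ∀ i, DfnF E 𝒳 (f i)) : Dfn E 𝒳 fun s => P fun i => f i s := by
  obtain ⟨K, hK⟩ := hP.support
  have key : ∀ j, Dfn E 𝒳 fun v =>
      P fun i => if i < j then f i (fun n => v (2 * n + 1)) else v (2 * i) := by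
    intro j
    induction j with
    | zero => 
      refine (hP.rename (f := fun n => 2 * n) ?_).congr fun s => by simp
      intro a b h
      simpa using h
    | succ j ih =>
      have h1 : Dfn E 𝒳 fun v => v 0 = f j fun n => v (2 * n + 1 + 1) := by
        have := (hf j).out.rename (f := fun n => if n = 0 then 0 else 2 * (n - 1) + 2)
          (by intro a b h; dsimp only at h; split_ifs at h <;> omega)
        exact this.congr fun s => by simp
      have h2 : Dfn E 𝒳 fun v =>
          P fun i => if i < j then f i (fun n => v (2 * n + 1 + 1))
            else if i = j then v 0 else v (2 * i + 1) := by
        have := ih.rename (f := fun n => if n = 2 * j then 0 else n + 1)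
          (by intro a b h; dsimp only at h; split_ifs at h <;> omega)
        refine this.congr fun s => ?_
        have e : ∀ n, 2 * n + 1 ≠ 2 * j := by intro n; omega
        simp [e, apply_ite s]
      refine (Dfn.ex (P := fun x v => x = f j (fun n => v (2 * n + 1)) ∧
        P fun i => if i < j then f i (fun n => v (2 * n + 1))
            else if i = j then x else v (2 * i)) (h1.and h2)).congr fun s => ?_
      simp only [exists_eq_left]
      apply iff_of_eq
      congr 1
      funext i
      rcases lt_trichotomy i j with h | h | h
      · simp [h, Nat.lt_succ_of_lt h]
      · simp [h]
      · simp [show ¬ i < j by omega, show ¬ i < j + 1 by omega, show i ≠ j by omega]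
  have h1 : Dfn E 𝒳 fun v => P fun i => f i (fun n => v (2 * n + 1)) :=
    (key K).congr fun s => hK _ _ fun i hi => by simp [hi]
  obtain ⟨L, hL⟩ := h1.support
  let g : ℕ → ℕ := fun i => if i % 2 = 1 ∧ i < L then i / 2 else i + L
  have hg : Function.Injective g := by
    intro a b h
    simp only [g] at h
    split_ifs at h <;> omega
  refine (h1.rename hg).congr fun s => ?_
  have := hL (fun n => if n % 2 = 1 then s (n / 2) else s (g n)) (fun n => s (g n)) (by
    intro i hi
    by_cases h : i % 2 = 1 <;> simp [g, h, hi])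
  rw [← this]
  have e : ∀ n, (2 * n + 1) / 2 = n := by intro n; omega
  simp [e]

theorem DfnF.comp {f : (ℕ → α) → α} (hf : DfnF E 𝒳 f) {g : ℕ → (ℕ → α) → α}
    (hg : ∀ i, DfnF E 𝒳 (g i)) : DfnF E 𝒳 fun s => f fun i => g i s := by
  refine ⟨(hf.out.comp (f := fun i s => Nat.casesOn i (s 0) fun i => g i fun n => s (n + 1))
    fun i => ?_).congr fun s => by simp⟩
  rcases i with _ | i
  · exact .var 0
  · exact (hg i).shift

theorem Dfn.comp1 {P : α → Prop} (hP : Dfn1 E 𝒳 P) {f : (ℕ → α) → α} (hf : DfnF E 𝒳 f) :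
    Dfn E 𝒳 fun s => P (f s) :=
  hP.out.comp (f := fun _ => f) fun _ => hf

theorem Dfn.comp2 {P : α → α → Prop} (hP : Dfn2 E 𝒳 P) {f g : (ℕ → α) → α} (hf : DfnF E 𝒳 f)
    (hg : DfnF E 𝒳 g) : Dfn E 𝒳 fun s => P (f s) (g s) :=
  hP.out.comp (f := fun i s => if i = 0 then f s else g s) fun i => by
    rcases i with _ | i
    · simpa using hf
    · simpa using hg

theorem Dfn.comp3 {P : α → α → α → Prop} (hP : Dfn3 E 𝒳 P) {f g k : (ℕ → α) → α}
    (hf : DfnF E 𝒳 f) (hg : DfnF E 𝒳 g) (hk : DfnF E 𝒳 k) :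
    Dfn E 𝒳 fun s => P (f s) (g s) (k s) :=
  hP.out.comp (f := fun i s => if i = 0 then f s else if i = 1 then g s else k s) fun i => by
    rcases i with _ | _ | i
    · simpa using hf
    · simpa using hg
    · simpa using hk

theorem DfnF.comp1 {F : α → α} (hF : DfnF1 E 𝒳 F) {f : (ℕ → α) → α} (hf : DfnF E 𝒳 f) :
    DfnF E 𝒳 fun s => F (f s) :=
  hF.out.comp (g := fun _ => f) fun _ => hf

theorem DfnF.comp2 {F : α → α → α} (hF : DfnF2 E 𝒳 F) {f g : (ℕ → α) → α} (hf : DfnF E 𝒳 f)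
    (hg : DfnF E 𝒳 g) : DfnF E 𝒳 fun s => F (f s) (g s) :=
  hF.out.comp (g := fun i s => if i = 0 then f s else g s) fun i => by
    rcases i with _ | i
    · simpa using hf
    · simpa using hg

theorem Dfn.eq {f g : (ℕ → α) → α} (hf : DfnF E 𝒳 f) (hg : DfnF E 𝒳 g) :
    Dfn E 𝒳 fun s => f s = g s :=
  Dfn.comp2 ⟨.eqVar 0 1⟩ hf hg

theorem Dfn.mem {f g : (ℕ → α) → α} (hf : DfnF E 𝒳 f) (hg : DfnF E 𝒳 g) :
    Dfn E 𝒳 fun s => E (f s) (g s) :=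
  Dfn.comp2 ⟨.memVar 0 1⟩ hf hg

theorem Dfn.tr {φ : Fml} (e : φ.IsElementary) {c : ℕ → Set α}
    (hc : ∀ n, Dfn1 E 𝒳 fun x => x ∈ c n) : Dfn E 𝒳 fun s => Tr E φ s c := by
  induction φ with
  | memSS i j => exact .memVar i j
  | memSC i j => exact .comp1 (hc j) (.var i)
  | eqS i j => exact .eqVar i j
  | fal => exact .false
  | imp φ ψ ih₁ ih₂ => exact (ih₁ e.1).imp (ih₂ e.2)
  | allS i φ ih => exact ((ih e).updAll i).congr fun s => by simp [Tr, Sat]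
  | allC i φ ih => exact e.elim

end Definability

section SetTheory

variable {α : Type} {E : α → α → Prop} {𝒳 : Set (Set α)}

theorem GBC.params (h : GBC Set.univ E 𝒳) : Params 𝒳 := by
  obtain ⟨a, -⟩ := h.1.zf.nonempty
  obtain ⟨F, hF, -⟩ := h.2
  refine ⟨⟨a⟩, fun b => ?_⟩
  obtain ⟨X, hX, hX'⟩ := h.1.elemComp (.eqS 0 1) trivial (fun _ => b) (by simp) (fun _ => F)
    fun _ => hF
  have : X = {b} := by
    ext x
    simpa [Sat] using hX' x trivial
  exact this ▸ hX

theorem GBC.comprehension (h : GBC Set.univ E 𝒳) {P : α → Prop} (hP : Dfn1 E 𝒳 P) :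
    {x | P x} ∈ 𝒳 := by
  obtain ⟨a, -⟩ := h.1.zf.nonempty
  obtain ⟨φ, e, c, hc, h'⟩ := hP.out.out
  obtain ⟨X, hX, hX'⟩ := h.1.elemComp φ e (fun _ => a) (by simp) c hc
  have : X = {x | P x} := by
    ext x
    rw [hX' x trivial, sat_elementary_iff e (𝒳' := ∅)]
    have := h' (Function.update (fun _ => a) 0 x)
    simpa using this.symm
  exact this ▸ hX

theorem isKPair_iff {p a b : α} : IsKPair Set.univ E p a b ↔
    ∀ z, E z p ↔ ((∀ w, E w z ↔ w = a) ∨ ∀ w, E w z ↔ (w = a ∨ w = b)) := by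
  simp [IsKPair]

theorem isOrdIn_iff {x : α} : IsOrdIn Set.univ E x ↔
    (∀ y, E y x → ∀ z, E z y → E z x) ∧ ∀ t, E t x → ∀ y, E y t → ∀ z, E z y → E z t := by
  simp [IsOrdIn, IsTransIn]

section

variable [Params 𝒳]

theorem isKPair_dfn : Dfn3 E 𝒳 (IsKPair Set.univ E) := by
  refine ⟨Dfn.congr ?_ fun s => isKPair_iff⟩
  exact auto_dfn

theorem isOrdIn_dfn : Dfn1 E 𝒳 (IsOrdIn Set.univ E) := by
  refine ⟨Dfn.congr ?_ fun s => isOrdIn_iff⟩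
  exact auto_dfn

theorem pairIn_dfn {F : Set α} (hF : Dfn1 E 𝒳 fun x => x ∈ F) :
    Dfn2 E 𝒳 (PairIn Set.univ E F) := by
  have hK := isKPair_dfn (E := E) (𝒳 := 𝒳)
  change Dfn2 E 𝒳 fun a b => ∃ p, p ∈ F ∧ IsKPair Set.univ E p a b
  exact auto_dfn

end

/-- A definable, set-like, well-behaved linear order of a model of set theory, together with
definable pairing functions. -/
structure Frame (E : α → α → Prop) (𝒳 : Set (Set α)) [LinearOrder α] where
  params : Params 𝒳
  compr : ∀ {P : α → Prop}, Dfn1 E 𝒳 P → {x | P x} ∈ 𝒳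
  lt_dfn : Dfn2 E 𝒳 fun a b => a < b
  ext : ∀ u v, (∀ x, E x u ↔ E x v) → u = v
  min : ∀ {P : α → Prop}, Dfn1 E 𝒳 P → (∃ x, P x) → ∃ x, P x ∧ ∀ y < x, ¬ P y
  sep : ∀ {P : α → Prop}, Dfn1 E 𝒳 P → ∀ a, ∃ u, ∀ x, E x u ↔ x < a ∧ P x
  bdd : ∀ u, ∃ b, ∀ x, E x u → x < b
  coll : ∀ {R : α → α → Prop}, Dfn2 E 𝒳 R → ∀ a, (∀ x < a, ∃ y, R x y) →
    ∃ b, ∀ x < a, ∃ y < b, R x y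
  pow : ∀ a, ∃ b, ∀ u, (∀ x, E x u → x < a) → u < b
  nomax : ∀ a : α, ∃ b, a < b
  repl : ∀ {R : α → α → Prop}, Dfn2 E 𝒳 R → (∀ x y y', R x y → R x y' → y = y') →
    ∀ u, ∃ b, ∀ y, E y b ↔ ∃ x, E x u ∧ R x y
  pr : α → α → α
  fst : α → α
  snd : α → α
  pr_dfn : DfnF2 E 𝒳 pr
  fst_dfn : DfnF1 E 𝒳 fst
  snd_dfn : DfnF1 E 𝒳 snd
  fst_pr : ∀ a b, fst (pr a b) = a
  snd_pr : ∀ a b, snd (pr a b) = b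

theorem GBC.repl (h : GBC Set.univ E 𝒳) {R : α → α → Prop} (hR : Dfn2 E 𝒳 R)
    (pr : α → α → α) (hpr : ∀ p a b, IsKPair Set.univ E p a b ↔ p = pr a b)
    (hinj : ∀ a b c d, pr a b = pr c d → a = c ∧ b = d)
    (hf : ∀ x y y', R x y → R x y' → y = y') (u : α) :
    ∃ b, ∀ y, E y b ↔ ∃ x, E x u ∧ R x y := by
  have := h.params
  have hK := isKPair_dfn (E := E) (𝒳 := 𝒳)
  have hF : {p | ∃ x y, IsKPair Set.univ E p x y ∧ R x y} ∈ 𝒳 := h.comprehension auto_dfn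
  have hp : ∀ x y, PairIn Set.univ E {p | ∃ x y, IsKPair Set.univ E p x y ∧ R x y} x y ↔ R x y := by
    intro x y
    simp only [PairIn, hpr, Set.mem_ofPred_eq]
    constructor
    · rintro ⟨p, ⟨x', y', rfl, hr⟩, h⟩
      obtain ⟨rfl, rfl⟩ := hinj _ _ _ _ h
      exact hr
    · exact fun hr => ⟨_, ⟨x, y, rfl, hr⟩, rfl⟩
  have := h.1.classRepl _ hF (fun x y y' => by rw [hp, hp]; exact hf x y y') u trivial
  simpa [hp] using this

theorem GBC.exists_pair (h : GBC Set.univ E 𝒳) : ∃ pr : α → α → α,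
    (∀ p a b, IsKPair Set.univ E p a b ↔ p = pr a b) ∧
    ∀ a b c d, pr a b = pr c d → a = c ∧ b = d := by
  have hext : ∀ x y, (∀ z, E z x ↔ E z y) → x = y := by simpa using h.1.zf.exten
  have hpair : ∀ x y, ∃ p, ∀ z, E z p ↔ (z = x ∨ z = y) := by simpa using h.1.zf.pairing
  choose up hup using hpair
  have hinj : ∀ a b c d, up a b = up c d → a = c ∧ b = d ∨ a = d ∧ b = c := by
    intro a b c d e
    have h1 : ∀ z, (z = a ∨ z = b) ↔ (z = c ∨ z = d) := fun z => by rw [← hup, ← hup, e]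
    have ha := (h1 a).1 (.inl rfl)
    have hb := (h1 b).1 (.inr rfl)
    have hc := (h1 c).2 (.inl rfl)
    have hd := (h1 d).2 (.inr rfl)
    grind
  have hS : ∀ z a, (∀ w, E w z ↔ w = a) ↔ z = up a a := fun z a =>
    ⟨fun hz => hext _ _ fun w => by rw [hz, hup]; simp, fun hz => by simp [hz, hup]⟩
  have hU : ∀ z a b, (∀ w, E w z ↔ (w = a ∨ w = b)) ↔ z = up a b := fun z a b =>
    ⟨fun hz => hext _ _ fun w => by rw [hz, hup], fun hz => by simp [hz, hup]⟩
  refine ⟨fun a b => up (up a a) (up a b), fun p a b => ?_, fun a b c d e => ?_⟩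
  · rw [isKPair_iff]
    simp only [hS, hU]
  · rcases hinj _ _ _ _ e with ⟨h1, h2⟩ | ⟨h1, h2⟩
    · have h3 := hinj _ _ _ _ h1
      have h4 := hinj _ _ _ _ h2
      clear * - h3 h4
      grind
    · have h3 := hinj _ _ _ _ h1
      have h4 := hinj _ _ _ _ h2
      clear * - h3 h4
      grind

theorem GBC.exists_frame (h : GBC Set.univ E 𝒳) : ∃ _ : LinearOrder α, Nonempty (Frame E 𝒳) := by
  have par := h.params
  have hK := isKPair_dfn (E := E) (𝒳 := 𝒳)
  obtain ⟨pr, hpr, prinj⟩ := h.exists_pair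
  have hrepl : ∀ {R : α → α → Prop}, Dfn2 E 𝒳 R → (∀ x y y', R x y → R x y' → y = y') →
      ∀ u, ∃ b, ∀ y, E y b ↔ ∃ x, E x u ∧ R x y := fun hR hf u => h.repl hR pr hpr prinj hf u
  have hext : ∀ x y, (∀ z, E z x ↔ E z y) → x = y := by simpa using h.1.zf.exten
  have hpair : ∀ x y, ∃ p, ∀ z, E z p ↔ (z = x ∨ z = y) := by simpa using h.1.zf.pairing
  have hunion : ∀ x, ∃ u, ∀ z, E z u ↔ ∃ w, E w x ∧ E z w := by simpa using h.1.zf.union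
  have hpow : ∀ x, ∃ p, ∀ z, E z p ↔ ∀ w, E w z → E w x := by simpa using h.1.zf.power
  have hfound : ∀ x, (∃ z, E z x) → ∃ m, E m x ∧ ∀ z, E z m → ¬ E z x := by
    simpa using h.1.zf.foundation
  have hsep : ∀ {P : α → Prop}, Dfn1 E 𝒳 P → ∀ a, ∃ u, ∀ x, E x u ↔ E x a ∧ P x := by
    intro P hP a
    obtain ⟨b, hb⟩ := hrepl (R := fun x y => x = y ∧ P x) auto_dfn
      (fun x y y' h h' => h.1.symm.trans h'.1) a
    exact ⟨b, fun x => by rw [hb]; aesop⟩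
  have hirr : ∀ x, ¬ E x x := by
    intro x hx
    obtain ⟨p, hp⟩ := hpair x x
    obtain ⟨m, hm, hm'⟩ := hfound p ⟨x, by simp [hp]⟩
    have : m = x := by simpa [hp] using hm
    subst this
    exact hm' m hx hm
  let O : α → Prop := IsOrdIn Set.univ E
  have hO : Dfn1 E 𝒳 O := isOrdIn_dfn
  have hOmem : ∀ x y, O x → E y x → O y := by
    intro x y hx hy
    have hx := isOrdIn_iff.1 hx
    exact isOrdIn_iff.2 ⟨hx.2 y hy, fun z hz => hx.2 z (hx.1 y hy z hz)⟩
  have hOtr : ∀ x y z, O x → E y x → E z y → E z x := fun x y z hx hy hz =>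
    (isOrdIn_iff.1 hx).1 y hy z hz
  have hOmin : ∀ {P : α → Prop}, Dfn1 E 𝒳 P → (∃ x, P x) → (∀ x, P x → O x) →
      ∃ x, P x ∧ ∀ y, E y x → ¬ P y := by
    intro P hP ⟨x, hx⟩ hPO
    by_cases hy : ∃ y, E y x ∧ P y
    · obtain ⟨u, hu⟩ := hsep hP x
      obtain ⟨m, hm, hm'⟩ := hfound u (hy.imp fun y hy => (hu y).2 hy)
      have hm2 := (hu m).1 hm
      exact ⟨m, hm2.2, fun y hy hPy =>
        hm' y hy ((hu y).2 ⟨hOtr x m y (hPO x hx) hm2.1 hy, hPy⟩)⟩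
    · exact ⟨x, hx, fun y hyx hPy => hy ⟨y, hyx, hPy⟩⟩
  have htri : ∀ a b, O a → O b → E a b ∨ a = b ∨ E b a := by
    by_contra! hcon
    obtain ⟨a₀, b₀, ha₀, hb₀, hab₀⟩ := hcon
    obtain ⟨a, ⟨ha, b₁, hb₁, hab₁⟩, hamin⟩ := hOmin
      (P := fun a => O a ∧ ∃ b, O b ∧ ¬ E a b ∧ a ≠ b ∧ ¬ E b a) auto_dfn ⟨a₀, ha₀, b₀, hb₀, hab₀⟩
      fun x hx => hx.1
    obtain ⟨b, ⟨hb, hab⟩, hbmin⟩ := hOmin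
      (P := fun b => O b ∧ ¬ E a b ∧ a ≠ b ∧ ¬ E b a) auto_dfn ⟨b₁, hb₁, hab₁⟩ fun x hx => hx.1
    refine hab.2.1 (hext _ _ fun z => ⟨fun hz => ?_, fun hz => ?_⟩)
    · have hzO := hOmem a z ha hz
      by_contra hzb
      refine hamin z hz ⟨hzO, b, hb, hzb, ?_, fun hbz => hab.2.2 (hOtr a z b ha hz hbz)⟩
      rintro rfl
      exact hab.2.2 hz
    · have hzO := hOmem b z hb hz
      by_contra hza
      refine hbmin z hz ⟨hzO, fun haz => hab.1 (hOtr b z a hb hz haz), ?_, hza⟩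
      rintro rfl
      exact hab.1 hz
  obtain ⟨F, hF, -, hF1, hF2, hF3, hF4⟩ := h.2
  have hF3' : ∀ x, ∃ y, PairIn Set.univ E F x y ∧ O y := fun x => hF3 x trivial
  choose ρ hρ hρO using hF3'
  have ρinj : ∀ x y, ρ x = ρ y → x = y := fun x y e => hF2 x y (ρ x) (hρ x) (e ▸ hρ y)
  have ρsurj : ∀ y, O y → ∃ x, ρ x = y := fun y hy => by
    obtain ⟨x, -, hx⟩ := hF4 y hy
    exact ⟨x, hF1 x _ _ (hρ x) hx⟩
  have ρdfn : DfnF1 E 𝒳 ρ := by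
    refine ⟨⟨(Dfn.comp2 (pairIn_dfn (.of_mem hF)) (.var 1) (.var 0)).congr fun s => ?_⟩⟩
    exact ⟨fun e => e ▸ hρ _, fun hp => hF1 _ _ _ hp (hρ _)⟩
  let lt : α → α → Prop := fun x y => E (ρ x) (ρ y)
  have hsto : IsStrictTotalOrder α lt :=
    { trichotomous := fun a b h1 h2 => by
        rcases htri _ _ (hρO a) (hρO b) with h | h | h
        exacts [(h1 h).elim, ρinj _ _ h, (h2 h).elim]
      irrefl := fun a => hirr _
      trans := fun a b c hab hbc => hOtr _ _ _ (hρO c) hbc hab }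
  classical
  let _ : LinearOrder α := linearOrderOfSTO lt
  have hlt : ∀ a b : α, a < b ↔ E (ρ a) (ρ b) := fun a b => Iff.rfl
  have ltd : Dfn2 E 𝒳 fun a b => a < b := by
    change Dfn2 E 𝒳 fun a b => E (ρ a) (ρ b)
    exact auto_dfn
  have hmin : ∀ {P : α → Prop}, Dfn1 E 𝒳 P → (∃ x, P x) → ∃ x, P x ∧ ∀ y < x, ¬ P y := by
    intro P hP ⟨x, hx⟩
    obtain ⟨o, ⟨y, hy, rfl⟩, ho⟩ := hOmin (P := fun o => ∃ x, P x ∧ o = ρ x) auto_dfn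
      ⟨_, x, hx, rfl⟩ (by rintro _ ⟨x, -, rfl⟩; exact hρO x)
    exact ⟨y, hy, fun z hz hPz => ho _ hz ⟨z, hPz, rfl⟩⟩
  have hseg : ∀ a : α, ∃ u, ∀ x, E x u ↔ x < a := by
    intro a
    obtain ⟨u, hu⟩ := hrepl (R := fun o x => o = ρ x) auto_dfn
      (fun x y y' h h' => ρinj _ _ (h.symm.trans h')) (ρ a)
    exact ⟨u, fun x => by rw [hu, hlt]; simp⟩
  have hbdd : ∀ u : α, ∃ b, ∀ x, E x u → x < b := by
    intro u
    obtain ⟨W, hW⟩ := hrepl (R := fun x o => o = ρ x) auto_dfn (fun x y y' h h' => h.trans h'.symm) u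
    obtain ⟨S, hS⟩ := hunion W
    obtain ⟨S1, hS1⟩ := hpair S S
    obtain ⟨S2, hS2⟩ := hpair S S1
    obtain ⟨T, hT⟩ := hunion S2
    have hT' : ∀ z, E z T ↔ E z S ∨ z = S := by
      intro z
      rw [hT]
      simp [hS2, hS1]
    have hWO : ∀ w, E w W → O w := by
      intro w hw
      obtain ⟨x, -, rfl⟩ := (hW w).1 hw
      exact hρO x
    have hSO : O S := by
      refine isOrdIn_iff.2 ⟨fun y hy z hz => ?_, fun y hy => ?_⟩
      · obtain ⟨w, hw, hyw⟩ := (hS y).1 hy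
        exact (hS z).2 ⟨w, hw, hOtr _ _ _ (hWO w hw) hyw hz⟩
      · obtain ⟨w, hw, hyw⟩ := (hS y).1 hy
        exact (isOrdIn_iff.1 (hOmem _ _ (hWO w hw) hyw)).1
    have hTO : O T := by
      refine isOrdIn_iff.2 ⟨fun y hy z hz => ?_, fun y hy => ?_⟩
      · rcases (hT' y).1 hy with hy | rfl
        · exact (hT' z).2 (.inl (hOtr _ _ _ hSO hy hz))
        · exact (hT' z).2 (.inl hz)
      · rcases (hT' y).1 hy with hy | rfl
        · exact (isOrdIn_iff.1 (hOmem _ _ hSO hy)).1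
        · exact (isOrdIn_iff.1 hSO).1
    obtain ⟨b, rfl⟩ := ρsurj T hTO
    refine ⟨b, fun x hx => ?_⟩
    rw [hlt, hT']
    rcases htri _ _ (hρO x) hSO with h | h | h
    · exact .inl h
    · exact .inr h
    · exact (hirr S ((hS S).2 ⟨ρ x, (hW _).2 ⟨x, hx, rfl⟩, h⟩)).elim
  have prd : DfnF2 E 𝒳 pr :=
    ⟨⟨(Dfn.comp3 isKPair_dfn (.var 0) (.var 1) (.var 2)).congr fun s => (hpr _ _ _).symm⟩⟩
  let fst : α → α := fun p => if h : ∃ a b, p = pr a b then h.choose else p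
  let snd : α → α := fun p => if h : ∃ a b, p = pr a b then h.choose_spec.choose else p
  have hfs : ∀ a b, fst (pr a b) = a ∧ snd (pr a b) = b := by
    intro a b
    have h : ∃ c d, pr a b = pr c d := ⟨a, b, rfl⟩
    have := prinj _ _ _ _ h.choose_spec.choose_spec
    simp only [fst, snd, dif_pos h]
    exact ⟨this.1.symm, this.2.symm⟩
  have hfs' : ∀ p, (¬ ∃ a b, p = pr a b) → fst p = p ∧ snd p = p := fun p h => by
    simp only [fst, snd, dif_neg h, and_self]
  refine ⟨inferInstance, ⟨⟨par, h.comprehension, ltd, hext, hmin, fun hP a => ?_, hbdd, ?_, ?_, ?_,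
    hrepl, pr, fst, snd, prd, ?_, ?_, fun a b => (hfs a b).1, fun a b => (hfs a b).2⟩⟩⟩
  · obtain ⟨v, hv⟩ := hseg a
    obtain ⟨u, hu⟩ := hsep hP v
    exact ⟨u, fun x => by rw [hu, hv]⟩
  · intro R hR a ha
    obtain ⟨v, hv⟩ := hseg a
    obtain ⟨w, hw⟩ := hrepl (R := fun x y => R x y ∧ ∀ y', y' < y → ¬ R x y') auto_dfn
      (fun x y y' h h' => by
        rcases lt_trichotomy y y' with hl | hl | hl
        exacts [(h'.2 _ hl h.1).elim, hl, (h.2 _ hl h'.1).elim]) v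
    obtain ⟨b, hb⟩ := hbdd w
    refine ⟨b, fun x hx => ?_⟩
    obtain ⟨y, hy, hy'⟩ := hmin (P := fun y => R x y) auto_dfn (ha x hx)
    exact ⟨y, hb y ((hw y).2 ⟨x, (hv x).2 hx, hy, hy'⟩), hy⟩
  · intro a
    obtain ⟨v, hv⟩ := hseg a
    obtain ⟨w, hw⟩ := hpow v
    obtain ⟨b, hb⟩ := hbdd w
    exact ⟨b, fun u hu => hb u ((hw u).2 fun x hx => (hv x).2 (hu x hx))⟩
  · intro a
    obtain ⟨w, hw⟩ := hpair a a
    obtain ⟨b, hb⟩ := hbdd w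
    exact ⟨b, hb a ((hw a).2 (.inl rfl))⟩
  · have : Dfn2 E 𝒳 fun x p => (∃ a b, p = pr a b ∧ x = a) ∨ ((¬ ∃ a b, p = pr a b) ∧ x = p) := auto_dfn
    refine ⟨⟨this.out.congr fun s => ?_⟩⟩
    dsimp only
    by_cases h : ∃ a b, s (0 + 1) = pr a b
    · obtain ⟨a, b, e⟩ := h
      simp only [zero_add] at e ⊢
      rw [e, (hfs a b).1]
      constructor
      · exact fun hs => .inl ⟨a, b, rfl, hs⟩
      · rintro (⟨c, d, e', hc⟩ | ⟨hn, -⟩)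
        · rw [hc, (prinj _ _ _ _ e').1]
        · exact (hn ⟨a, b, rfl⟩).elim
    · rw [(hfs' _ h).1]
      simp only [zero_add] at h ⊢
      exact ⟨fun hs => .inr ⟨h, hs⟩, fun hs => hs.elim
        (fun ⟨a, b, e, _⟩ => (h ⟨a, b, e⟩).elim) fun hs => hs.2⟩
  · have : Dfn2 E 𝒳 fun x p => (∃ a b, p = pr a b ∧ x = b) ∨ ((¬ ∃ a b, p = pr a b) ∧ x = p) := auto_dfn
    refine ⟨⟨this.out.congr fun s => ?_⟩⟩
    dsimp only
    by_cases h : ∃ a b, s (0 + 1) = pr a b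
    · obtain ⟨a, b, e⟩ := h
      simp only [zero_add] at e ⊢
      rw [e, (hfs a b).2]
      constructor
      · exact fun hs => .inl ⟨a, b, rfl, hs⟩
      · rintro (⟨c, d, e', hc⟩ | ⟨hn, -⟩)
        · rw [hc, (prinj _ _ _ _ e').2]
        · exact (hn ⟨a, b, rfl⟩).elim
    · rw [(hfs' _ h).2]
      simp only [zero_add] at h ⊢
      exact ⟨fun hs => .inr ⟨h, hs⟩, fun hs => hs.elim
        (fun ⟨a, b, e, _⟩ => (h ⟨a, b, e⟩).elim) fun hs => hs.2⟩

namespace Frame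

variable [LinearOrder α]

theorem le_dfn (F : Frame E 𝒳) : Dfn2 E 𝒳 fun a b => a ≤ b :=
  have := F.params
  ⟨(Dfn.comp2 F.lt_dfn (.var 1) (.var 0)).not.congr fun _ => not_lt.symm⟩

theorem induction (F : Frame E 𝒳) {P : α → Prop} (hP : Dfn1 E 𝒳 P)
    (h : ∀ x, (∀ y < x, P y) → P x) (x : α) : P x := by
  have := F.params
  by_contra hx
  obtain ⟨y, hy, hy'⟩ := F.min (P := fun x => ¬ P x) auto_dfn ⟨x, hx⟩
  exact hy (h y fun z hz => not_not.1 (hy' z hz))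

theorem exists_choice (F : Frame E 𝒳) {R : α → α → Prop} (hR : Dfn2 E 𝒳 R)
    (h : ∀ p, ∃ z, R p z) : ∃ G : α → α, DfnF1 E 𝒳 G ∧ ∀ p, R p (G p) := by
  have := F.params
  have hlt := F.lt_dfn
  have h' : ∀ p, ∃ z, R p z ∧ ∀ y < z, ¬ R p y := fun p => F.min (P := R p) auto_dfn (h p)
  choose G hG hG' using h'
  refine ⟨G, ⟨⟨?_⟩⟩, hG⟩
  have hd : Dfn2 E 𝒳 fun z p => R p z ∧ ∀ y, y < z → ¬ R p y := auto_dfn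
  refine hd.out.congr fun s => ⟨?_, fun hs => ?_⟩
  · rintro hs
    simp only [zero_add] at hs
    rw [hs]
    exact ⟨hG _, hG' _⟩
  · rcases lt_trichotomy (s 0) (G (s 1)) with hl | hl | hl
    exacts [(hG' _ _ hl hs.1).elim, hl, (hs.2 _ hl (hG _)).elim]

end Frame

end SetTheory

set_option hygiene false in
local notation "frame_auto_dfn" => by have := Frame.params ‹Frame _ _›; have := Frame.lt_dfn ‹Frame _ _›; have := Frame.le_dfn ‹Frame _ _›; have := Frame.pr_dfn ‹Frame _ _›; have := Frame.fst_dfn ‹Frame _ _›; have := Frame.snd_dfn ‹Frame _ _›; have := Frame.node_dfn ‹Frame _ _›; have := Frame.isExt_dfn ‹Frame _ _›; repeat' first | assumption | refine Dfn1.mk ?_ | refine Dfn2.mk ?_ | refine Dfn3.mk ?_ | refine DfnF1.mk ?_ | refine DfnF2.mk ?_ | exact DfnF.var _ | exact DfnF.const _ | with_reducible apply Dfn.not | with_reducible apply Dfn.iff | with_reducible apply Dfn.and | with_reducible apply Dfn.or | with_reducible apply Dfn.eq | with_reducible apply Dfn.mem | with_reducible exact Dfn.const _ | with_reducible apply Dfn.comp3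 | with_reducible apply Dfn.comp2 | with_reducible apply Dfn.comp1 | with_reducible apply DfnF.comp2 | with_reducible apply DfnF.comp1 | with_reducible apply Dfn.imp | refine Dfn.ex ?_ | refine Dfn.all ?_

section Nodes

variable {α : Type} {E : α → α → Prop} {𝒳 : Set (Set α)} [LinearOrder α]

namespace Frame

/-- `p` codes a subset of the proper initial segment below its length. -/
def Node (F : Frame E 𝒳) (p : α) : Prop :=
  p = F.pr (F.fst p) (F.snd p) ∧ ∀ x, E x (F.snd p) → x < F.fst p

/-- The node `q` end-extends the node `p`. -/
def IsExt (F : Frame E 𝒳) (p q : α) : Prop :=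
  F.fst p ≤ F.fst q ∧ ∀ x, x < F.fst p → (E x (F.snd p) ↔ E x (F.snd q))

theorem node_dfn (F : Frame E 𝒳) : Dfn1 E 𝒳 F.Node := by
  have := F.params
  have := F.lt_dfn
  have := F.pr_dfn
  have := F.fst_dfn
  have := F.snd_dfn
  unfold Node
  exact auto_dfn

theorem isExt_dfn (F : Frame E 𝒳) : Dfn2 E 𝒳 F.IsExt := by
  have := F.params
  have := F.lt_dfn
  have := F.le_dfn
  have := F.fst_dfn
  have := F.snd_dfn
  unfold IsExt
  exact auto_dfn

end Frame

namespace Frame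

variable {F : Frame E 𝒳} {p q r : α}

theorem IsExt.refl (F : Frame E 𝒳) (p : α) : F.IsExt p p := ⟨le_rfl, fun _ _ => Iff.rfl⟩

theorem IsExt.trans (h : F.IsExt p q) (h' : F.IsExt q r) : F.IsExt p r :=
  ⟨h.1.trans h'.1, fun x hx => (h.2 x hx).trans (h'.2 x (hx.trans_le h.1))⟩

theorem IsExt.of_le (h : F.IsExt p r) (h' : F.IsExt q r) (hl : F.fst p ≤ F.fst q) : F.IsExt p q :=
  ⟨hl, fun x hx => (h.2 x hx).trans (h'.2 x (hx.trans_le hl)).symm⟩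

theorem IsExt.total (h : F.IsExt p r) (h' : F.IsExt q r) : F.IsExt p q ∨ F.IsExt q p :=
  (le_total (F.fst p) (F.fst q)).imp (h.of_le h') (h'.of_le h)

theorem IsExt.antisymm (h : F.IsExt p q) (h' : F.fst q ≤ F.fst p) (hp : F.Node p) (hq : F.Node q) :
    p = q := by
  have e := le_antisymm h.1 h'
  have e' : F.snd p = F.snd q := F.ext _ _ fun x =>
    ⟨fun hx => (h.2 x (hp.2 x hx)).1 hx, fun hx => (h.2 x (e ▸ hq.2 x hx)).2 hx⟩
  rw [hp.1, hq.1, e, e']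

theorem IsExt.lt_of_ne (h : F.IsExt p q) (hp : F.Node p) (hq : F.Node q) (hne : p ≠ q) :
    F.fst p < F.fst q :=
  lt_of_not_ge fun hl => hne (h.antisymm hl hp hq)

theorem exists_diff (h : ¬ F.IsExt p q) (h' : ¬ F.IsExt q p) :
    ∃ e, e < F.fst p ∧ e < F.fst q ∧ ¬ (E e (F.snd p) ↔ E e (F.snd q)) := by
  by_contra! hcon
  rcases le_total (F.fst p) (F.fst q) with hl | hl
  · exact h ⟨hl, fun x hx => hcon x hx (hx.trans_le hl)⟩
  · exact h' ⟨hl, fun x hx => (hcon x (hx.trans_le hl) hx).symm⟩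

theorem exists_node (F : Frame E 𝒳) {P : α → Prop} (hP : Dfn1 E 𝒳 P) (a : α) :
    ∃ p, F.Node p ∧ F.fst p = a ∧ ∀ x, x < a → (E x (F.snd p) ↔ P x) := by
  obtain ⟨u, hu⟩ := F.sep hP a
  refine ⟨F.pr a u, ⟨by rw [F.fst_pr, F.snd_pr], fun x hx => ?_⟩, F.fst_pr _ _, fun x hx => ?_⟩
  · rw [F.snd_pr] at hx
    rw [F.fst_pr]
    exact ((hu x).1 hx).1
  · rw [F.snd_pr, hu, and_iff_right hx]

theorem exists_restrict (F : Frame E 𝒳) (r : α) {a : α} (ha : a ≤ F.fst r) :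
    ∃ p, F.Node p ∧ F.fst p = a ∧ F.IsExt p r := by
  obtain ⟨p, hp, hl, hb⟩ := F.exists_node (P := fun x => E x (F.snd r)) frame_auto_dfn a
  exact ⟨p, hp, hl, hl.trans_le ha, fun x hx => hb x (hl ▸ hx)⟩

theorem length_induction (F : Frame E 𝒳) {P : α → Prop} (hP : Dfn1 E 𝒳 P)
    (h : ∀ p, (∀ q, F.fst q < F.fst p → P q) → P p) (p : α) : P p := by
  have := F.induction (P := fun a => ∀ p, F.fst p = a → P p) frame_auto_dfn
    (fun a ih p hp => h p fun q hq => ih _ (hp ▸ hq) q rfl)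
  exact this _ p rfl

theorem exists_least (F : Frame E 𝒳) : ∃ a : α, ∀ x, a ≤ x := by
  obtain ⟨a⟩ := F.params.nonempty
  obtain ⟨b, -, hb⟩ := F.min (P := fun _ => True) frame_auto_dfn ⟨a, trivial⟩
  exact ⟨b, fun x => not_lt.1 fun hx => hb x hx trivial⟩

theorem node_bound (F : Frame E 𝒳) (d : α) : ∃ b, ∀ p, F.Node p → F.fst p < d → p < b := by
  have key : ∀ a, ∃ y, ∀ u, (∀ x, E x u → x < a) → F.pr a u < y := by
    intro a
    obtain ⟨b, hb⟩ := F.pow a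
    obtain ⟨b', hb'⟩ := F.coll (R := fun u y => F.pr a u < y) frame_auto_dfn b fun u _ => F.nomax _
    refine ⟨b', fun u hu => ?_⟩
    obtain ⟨y, hy, hy'⟩ := hb' u (hb u hu)
    exact hy'.trans hy
  obtain ⟨b, hb⟩ := F.coll (R := fun a y => ∀ u, (∀ x, E x u → x < a) → F.pr a u < y)
    frame_auto_dfn d fun a _ => key a
  refine ⟨b, fun p hp hl => ?_⟩
  obtain ⟨y, hy, hy'⟩ := hb _ hl
  rw [hp.1]
  exact (hy' _ hp.2).trans hy

/-- Perfect trees of nodes. -/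
structure Cond (F : Frame E 𝒳) (T : α → Prop) : Prop where
  dfn : Dfn1 E 𝒳 T
  node : ∀ p, T p → F.Node p
  down : ∀ p q, T p → F.Node q → F.IsExt q p → T q
  long : ∀ p, T p → ∀ d, ∃ q, T q ∧ F.IsExt p q ∧ d ≤ F.fst q
  split : ∀ p, T p → ∃ q₀ q₁, T q₀ ∧ T q₁ ∧ F.IsExt p q₀ ∧ F.IsExt p q₁ ∧
    ¬ F.IsExt q₀ q₁ ∧ ¬ F.IsExt q₁ q₀
  lim : ∀ p, F.Node p → (∀ d, d < F.fst p → ∃ q, T q ∧ F.IsExt q p ∧ d < F.fst q ∧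
    F.fst q < F.fst p) → T p

/-- Functions choosing two incomparable extensions of every node of a tree. -/
structure Splitter (F : Frame E 𝒳) (T : α → Prop) (g₀ g₁ : α → α) : Prop where
  cond : F.Cond T
  dfn₀ : DfnF1 E 𝒳 g₀
  dfn₁ : DfnF1 E 𝒳 g₁
  mem₀ : ∀ p, T p → T (g₀ p)
  mem₁ : ∀ p, T p → T (g₁ p)
  ext₀ : ∀ p, T p → F.IsExt p (g₀ p)
  ext₁ : ∀ p, T p → F.IsExt p (g₁ p)
  inc₀ : ∀ p, T p → ¬ F.IsExt (g₀ p) (g₁ p)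
  inc₁ : ∀ p, T p → ¬ F.IsExt (g₁ p) (g₀ p)

/-- `q` is obtained from nodes in `Q` in one step: as a chosen successor or as a limit. -/
def Step (F : Frame E 𝒳) (g₀ g₁ : α → α) (Q : α → Prop) (q : α) : Prop :=
  (∃ c, Q c ∧ F.IsExt c q ∧ F.fst c < F.fst q ∧ (q = g₀ c ∨ q = g₁ c)) ∨
    ∀ d, d < F.fst q → ∃ c, Q c ∧ F.IsExt c q ∧ d < F.fst c ∧ F.fst c < F.fst q

theorem Step.mono {g₀ g₁ : α → α} {Q Q' : α → Prop} (h : F.Step g₀ g₁ Q q)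
    (hQ : ∀ c, F.IsExt c q → Q c → Q' c) : F.Step g₀ g₁ Q' q :=
  h.imp (fun ⟨c, h1, h2, h3⟩ => ⟨c, hQ c h2 h1, h2, h3⟩)
    fun h d hd => let ⟨c, h1, h2, h3⟩ := h d hd; ⟨c, hQ c h2 h1, h2, h3⟩

/-- The nodes generated by the chosen successors and limits. -/
def Start (F : Frame E 𝒳) (g₀ g₁ : α → α) (p : α) : Prop :=
  F.Node p ∧ ∀ L, (∀ q, F.Node q → F.IsExt q p →
    F.Step g₀ g₁ (fun c => F.Node c ∧ E (F.fst c) L ∧ F.IsExt c p) q → E (F.fst q) L) →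
      E (F.fst p) L

theorem start_dfn {g₀ g₁ : α → α} (h₀ : DfnF1 E 𝒳 g₀) (h₁ : DfnF1 E 𝒳 g₁) :
    Dfn1 E 𝒳 (F.Start g₀ g₁) := by
  unfold Start Step
  exact frame_auto_dfn

theorem Start.of_step {g₀ g₁ : α → α} (hp : F.Node p) (h : F.Step g₀ g₁ (F.Start g₀ g₁) p) :
    F.Start g₀ g₁ p := by
  refine ⟨hp, fun L hL => hL p hp (.refl F p) (h.mono fun c hcp hc => ⟨hc.1, ?_, hcp⟩)⟩
  exact hc.2 L fun q hq hqc hs =>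
    hL q hq (hqc.trans hcp) (hs.mono fun c _ hc => ⟨hc.1, hc.2.1, hc.2.2.trans hcp⟩)

theorem Start.step {g₀ g₁ : α → α} (h₀ : DfnF1 E 𝒳 g₀) (h₁ : DfnF1 E 𝒳 g₁)
    (h : F.Start g₀ g₁ p) : F.Step g₀ g₁ (F.Start g₀ g₁) p := by
  have hs : Dfn1 E 𝒳 (F.Start g₀ g₁) := start_dfn h₀ h₁
  obtain ⟨b, hb⟩ := F.nomax (F.fst p)
  have hd : Dfn1 E 𝒳 fun a => ∃ q, F.Node q ∧ F.IsExt q p ∧ F.fst q = a ∧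
      F.Step g₀ g₁ (F.Start g₀ g₁) q := by
    unfold Step
    exact frame_auto_dfn
  obtain ⟨L, hL⟩ := F.sep hd b
  have hp := h.2 L fun q hq hqp hst => (hL _).2 ⟨hqp.1.trans_lt hb, q, hq, hqp, rfl,
    hst.mono fun c hcq ⟨hc, hcL, hcp⟩ => by
      obtain ⟨-, q', hq', hqp', e, hst'⟩ := (hL _).1 hcL
      obtain rfl : q' = c := (hqp'.of_le hcp e.le).antisymm e.ge hq' hc
      exact .of_step hq' hst'⟩
  obtain ⟨-, q, hq, hqp, e, hst⟩ := (hL _).1 hp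
  obtain rfl : q = p := hqp.antisymm e.ge hq h.1
  exact hst

namespace Splitter

variable {T : α → Prop} {g₀ g₁ : α → α}

theorem start_mem (hS : F.Splitter T g₀ g₁) : ∀ p, F.Start g₀ g₁ p → T p := by
  have hd := hS.cond.dfn
  have hs : Dfn1 E 𝒳 (F.Start g₀ g₁) := start_dfn hS.dfn₀ hS.dfn₁
  refine F.length_induction frame_auto_dfn fun p ih hp => ?_
  rcases hp.step hS.dfn₀ hS.dfn₁ with ⟨c, hc, -, hl, rfl | rfl⟩ | h
  · exact hS.mem₀ c (ih c hl hc)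
  · exact hS.mem₁ c (ih c hl hc)
  · refine hS.cond.lim p hp.1 fun d hd => ?_
    obtain ⟨c, hc, h1, h2, h3⟩ := h d hd
    exact ⟨c, ih c h3 hc, h1, h2, h3⟩

theorem lt₀ (hS : F.Splitter T g₀ g₁) (hp : T p) : F.fst p < F.fst (g₀ p) := by
  refine (hS.ext₀ p hp).lt_of_ne (hS.cond.node p hp) (hS.cond.node _ (hS.mem₀ p hp)) fun e => ?_
  exact hS.inc₀ p hp (e ▸ hS.ext₁ p hp)

theorem lt₁ (hS : F.Splitter T g₀ g₁) (hp : T p) : F.fst p < F.fst (g₁ p) := by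
  refine (hS.ext₁ p hp).lt_of_ne (hS.cond.node p hp) (hS.cond.node _ (hS.mem₁ p hp)) fun e => ?_
  exact hS.inc₁ p hp (e ▸ hS.ext₀ p hp)

theorem start₀ (hS : F.Splitter T g₀ g₁) (hp : F.Start g₀ g₁ p) : F.Start g₀ g₁ (g₀ p) :=
  have hm := hS.start_mem p hp
  .of_step (hS.cond.node _ (hS.mem₀ p hm)) (.inl ⟨p, hp, hS.ext₀ p hm, hS.lt₀ hm, .inl rfl⟩)

theorem start₁ (hS : F.Splitter T g₀ g₁) (hp : F.Start g₀ g₁ p) : F.Start g₀ g₁ (g₁ p) :=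
  have hm := hS.start_mem p hp
  .of_step (hS.cond.node _ (hS.mem₁ p hm)) (.inl ⟨p, hp, hS.ext₁ p hm, hS.lt₁ hm, .inr rfl⟩)

theorem step_start (hS : F.Splitter T g₀ g₁) : ∀ q, ∀ p, F.Start g₀ g₁ p → F.Start g₀ g₁ q →
    F.IsExt p q → p ≠ q → F.IsExt (g₀ p) q ∨ F.IsExt (g₁ p) q := by
  have h₀ := hS.dfn₀
  have h₁ := hS.dfn₁
  have hs : Dfn1 E 𝒳 (F.Start g₀ g₁) := start_dfn hS.dfn₀ hS.dfn₁
  refine F.length_induction frame_auto_dfn fun q ih p hp hq hpq hne => ?_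
  have hlt := hpq.lt_of_ne hp.1 hq.1 hne
  rcases hq.step hS.dfn₀ hS.dfn₁ with ⟨c, hc, hcq, hl, e⟩ | h
  · rcases hpq.total hcq with hpc | hcp
    · by_cases hpc' : p = c
      · subst hpc'
        rcases e with rfl | rfl
        exacts [.inl (.refl F _), .inr (.refl F _)]
      · exact (ih c hl p hp hc hpc hpc').imp (·.trans hcq) (·.trans hcq)
    · have hm := hS.start_mem c hc
      by_cases hcp' : c = p
      · subst hcp'
        rcases e with rfl | rfl
        exacts [.inl (.refl F _), .inr (.refl F _)]
      · exfalso
        rcases ih p hlt c hc hp hcp hcp' with h | h <;> rcases e with rfl | rfl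
        · exact absurd h.1 (not_le.2 hlt)
        · exact hS.inc₀ c hm (h.trans hpq)
        · exact hS.inc₁ c hm (h.trans hpq)
        · exact absurd h.1 (not_le.2 hlt)
  · obtain ⟨c, hc, hcq, hl, hl'⟩ := h _ hlt
    refine (ih c hl' p hp hc (hpq.of_le hcq hl.le) ?_).imp (·.trans hcq) (·.trans hcq)
    rintro rfl
    exact lt_irrefl _ hl

theorem sup_start {A : α → Prop} (hA : Dfn1 E 𝒳 A)
    (hAS : ∀ c, A c → F.Start g₀ g₁ c) (hAr : ∀ c, A c → F.IsExt c r) :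
    (∃ w, A w ∧ ∀ c, A c → F.IsExt c w) ∨
      ∃ w, F.Start g₀ g₁ w ∧ F.IsExt w r ∧ (∀ c, A c → F.IsExt c w ∧ F.fst c < F.fst w) ∧
        ∀ d, d < F.fst w → ∃ c, A c ∧ d < F.fst c := by
  obtain ⟨a, ha, ha'⟩ := F.min (P := fun a => ∀ c, A c → F.fst c ≤ a) frame_auto_dfn
    ⟨F.fst r, fun c hc => (hAr c hc).1⟩
  by_cases hm : ∃ w, A w ∧ F.fst w = a
  · obtain ⟨w, hw, rfl⟩ := hm
    exact .inl ⟨w, hw, fun c hc => (hAr c hc).of_le (hAr w hw) (ha c hc)⟩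
  · right
    push Not at hm
    obtain ⟨w, hw, rfl, hwr⟩ := F.exists_restrict r (a := a)
      (not_lt.1 fun h => ha' _ h fun c hc => (hAr c hc).1)
    have h1 : ∀ c, A c → F.IsExt c w ∧ F.fst c < F.fst w := fun c hc =>
      have := (ha c hc).lt_of_ne (hm c hc)
      ⟨(hAr c hc).of_le hwr this.le, this⟩
    have h2 : ∀ d, d < F.fst w → ∃ c, A c ∧ d < F.fst c := fun d hd => by
      have := ha' d hd
      push Not at this
      exact this
    refine ⟨w, .of_step hw (.inr fun d hd => ?_), hwr, h1, h2⟩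
    obtain ⟨c, hc, hcd⟩ := h2 d hd
    exact ⟨c, hAS c hc, (h1 c hc).1, hcd, (h1 c hc).2⟩

theorem max_start (hS : F.Splitter T g₀ g₁) (r p : α) : ∃ w, F.Start g₀ g₁ w ∧ F.IsExt w r ∧
    F.IsExt w p ∧ ∀ c, F.Start g₀ g₁ c → F.IsExt c r → F.IsExt c p → F.IsExt c w := by
  have hs : Dfn1 E 𝒳 (F.Start g₀ g₁) := start_dfn hS.dfn₀ hS.dfn₁
  rcases sup_start (F := F) (r := r) (A := fun c => F.Start g₀ g₁ c ∧ F.IsExt c r ∧ F.IsExt c p)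
    frame_auto_dfn (fun c hc => hc.1) (fun c hc => hc.2.1) with ⟨w, hw, hm⟩ | ⟨w, hw, hwr, h1, h2⟩
  · exact ⟨w, hw.1, hw.2.1, hw.2.2, fun c h1 h2 h3 => hm c ⟨h1, h2, h3⟩⟩
  · refine ⟨w, hw, hwr, ⟨?_, fun x hx => ?_⟩, fun c hc h3 h4 => (h1 c ⟨hc, h3, h4⟩).1⟩
    · by_contra! hl
      obtain ⟨c, hc, hcl⟩ := h2 _ hl
      exact absurd hc.2.2.1 (not_le.2 hcl)
    · obtain ⟨c, hc, hcl⟩ := h2 _ hx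
      rw [← (h1 c hc).1.2 x hcl, hc.2.2.2 x hcl]

theorem meet (hS : F.Splitter T g₀ g₁) (hr : F.Start g₀ g₁ r) (hp : F.Start g₀ g₁ p)
    (hrp : ¬ F.IsExt r p) (hpr : ¬ F.IsExt p r) : ∃ w, F.Start g₀ g₁ w ∧ F.IsExt w r ∧
    F.IsExt w p ∧ (∀ c, F.Start g₀ g₁ c → F.IsExt c r → F.IsExt c p → F.IsExt c w) ∧
    (F.IsExt (g₀ w) r ∧ F.IsExt (g₁ w) p ∨ F.IsExt (g₁ w) r ∧ F.IsExt (g₀ w) p) := by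
  obtain ⟨w, hw, hwr, hwp, hm⟩ := hS.max_start r p
  refine ⟨w, hw, hwr, hwp, hm, ?_⟩
  have hT := hS.start_mem w hw
  rcases hS.step_start r w hw hr hwr (by rintro rfl; exact hrp hwp) with h | h <;>
    rcases hS.step_start p w hw hp hwp (by rintro rfl; exact hpr hwr) with h' | h'
  · exact absurd (hm _ (hS.start₀ hw) h h').1 (not_le.2 (hS.lt₀ hT))
  · exact .inl ⟨h, h'⟩
  · exact .inr ⟨h, h'⟩
  · exact absurd (hm _ (hS.start₁ hw) h h').1 (not_le.2 (hS.lt₁ hT))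

/-- The tree of all initial segments of generated nodes. -/
def tree (F : Frame E 𝒳) (g₀ g₁ : α → α) (q : α) : Prop :=
  F.Node q ∧ ∃ r, F.Start g₀ g₁ r ∧ F.IsExt q r

theorem exists_start_le (hS : F.Splitter T g₀ g₁) (d : α) : ∃ d', ∀ r, tree F g₀ g₁ r →
    d' ≤ F.fst r → ∃ c, F.Start g₀ g₁ c ∧ F.IsExt c r ∧ d ≤ F.fst c := by
  have h₀ := hS.dfn₀
  have h₁ := hS.dfn₁
  obtain ⟨b, hb⟩ := F.node_bound d
  obtain ⟨e, he⟩ := F.coll (R := fun p y => F.fst (g₀ p) ≤ y ∧ F.fst (g₁ p) ≤ y) frame_auto_dfn b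
    fun p _ => ⟨max (F.fst (g₀ p)) (F.fst (g₁ p)), le_max_left _ _, le_max_right _ _⟩
  have he' : ∀ p < b, F.fst (g₀ p) < e ∧ F.fst (g₁ p) < e := fun p hp =>
    let ⟨y, hy, h1, h2⟩ := he p hp
    ⟨h1.trans_lt hy, h2.trans_lt hy⟩
  refine ⟨e, fun r ⟨hr, s, hs, hrs⟩ her => ?_⟩
  obtain ⟨w, hw, hwr, -, hm⟩ := hS.max_start r r
  refine ⟨w, hw, hwr, not_lt.1 fun hl => ?_⟩
  have hwb := he' w (hb w hw.1 hl)
  have hT := hS.start_mem w hw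
  by_cases hws : w = s
  · subst hws
    exact absurd (hwb.1.trans_le (her.trans hrs.1)) (not_lt.2 (hS.lt₀ hT).le)
  · rcases hS.step_start s w hw hs (hwr.trans hrs) hws with h | h
    · have h' := h.of_le hrs (hwb.1.le.trans her)
      exact absurd (hm _ (hS.start₀ hw) h' h').1 (not_le.2 (hS.lt₀ hT))
    · have h' := h.of_le hrs (hwb.2.le.trans her)
      exact absurd (hm _ (hS.start₁ hw) h' h').1 (not_le.2 (hS.lt₁ hT))

theorem tree_lim (hS : F.Splitter T g₀ g₁) (hp : F.Node p)
    (h : ∀ d, d < F.fst p → ∃ q, tree F g₀ g₁ q ∧ F.IsExt q p ∧ d < F.fst q ∧ F.fst q < F.fst p) :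
    tree F g₀ g₁ p := by
  obtain ⟨w, hw, hwp, -, hm⟩ := hS.max_start p p
  have hT := hS.start_mem w hw
  by_cases hwp' : w = p
  · subst hwp'
    exact ⟨hp, w, hw, .refl F w⟩
  have hlt := hwp.lt_of_ne hw.1 hp hwp'
  by_cases h0 : F.IsExt p (g₀ w)
  · exact ⟨hp, _, hS.start₀ hw, h0⟩
  by_cases h1 : F.IsExt p (g₁ w)
  · exact ⟨hp, _, hS.start₁ hw, h1⟩
  obtain ⟨e₀, hp0, hg0, hd0⟩ := exists_diff h0
    fun h' => absurd (hm _ (hS.start₀ hw) h' h').1 (not_le.2 (hS.lt₀ hT))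
  obtain ⟨e₁, hp1, hg1, hd1⟩ := exists_diff h1
    fun h' => absurd (hm _ (hS.start₁ hw) h' h').1 (not_le.2 (hS.lt₁ hT))
  obtain ⟨q, ⟨hq, s, hs, hqs⟩, hqp, hql, hql'⟩ :=
    h (max (F.fst w) (max e₀ e₁)) (max_lt hlt (max_lt hp0 hp1))
  simp only [max_lt_iff] at hql
  have hwq := hwp.of_le hqp hql.1.le
  rcases hS.step_start s w hw hs (hwq.trans hqs)
    (by rintro rfl; exact absurd hqs.1 (not_le.2 hql.1)) with h' | h'
  · exact (hd0 (by rw [← hqp.2 _ hql.2.1, hqs.2 _ hql.2.1, h'.2 _ hg0])).elim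
  · exact (hd1 (by rw [← hqp.2 _ hql.2.2, hqs.2 _ hql.2.2, h'.2 _ hg1])).elim

/-- `q` is a generated node extending `p` by leftmost choices. -/
def Leftmost (F : Frame E 𝒳) (g₀ g₁ : α → α) (p q : α) : Prop :=
  F.Start g₀ g₁ q ∧ F.IsExt p q ∧
    ∀ c, F.Start g₀ g₁ c → F.IsExt p c → F.IsExt c q → c ≠ q → F.IsExt (g₀ c) q

theorem leftmost_dfn (hS : F.Splitter T g₀ g₁) : Dfn2 E 𝒳 (Leftmost F g₀ g₁) := by
  have h₀ := hS.dfn₀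
  have h₁ := hS.dfn₁
  have hs : Dfn1 E 𝒳 (F.Start g₀ g₁) := start_dfn hS.dfn₀ hS.dfn₁
  unfold Leftmost
  exact frame_auto_dfn

theorem Leftmost.total (hS : F.Splitter T g₀ g₁) (hp : F.Start g₀ g₁ p) {q r : α}
    (hq : Leftmost F g₀ g₁ p q) (hr : Leftmost F g₀ g₁ p r) : F.IsExt q r ∨ F.IsExt r q := by
  by_contra! hcon
  obtain ⟨w, hw, hwq, hwr, hm, h⟩ := hS.meet hq.1 hr.1 hcon.1 hcon.2
  have hT := hS.start_mem w hw
  have h0 := hq.2.2 w hw (hm p hp hq.2.1 hr.2.1) hwq (by rintro rfl; exact hcon.1 hwr)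
  have h1 := hr.2.2 w hw (hm p hp hq.2.1 hr.2.1) hwr (by rintro rfl; exact hcon.2 hwq)
  rcases h with ⟨-, h⟩ | ⟨h, -⟩
  · exact (h1.total h).elim (hS.inc₀ w hT) (hS.inc₁ w hT)
  · exact (h0.total h).elim (hS.inc₀ w hT) (hS.inc₁ w hT)

theorem exists_long (hS : F.Splitter T g₀ g₁) (hp : F.Start g₀ g₁ p) (d : α) :
    ∃ q, F.Start g₀ g₁ q ∧ F.IsExt p q ∧ d ≤ F.fst q := by
  by_contra! hcon
  have hd := leftmost_dfn hS
  have hl : Leftmost F g₀ g₁ p p := ⟨hp, .refl F p, fun c hc h1 h2 h3 =>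
    (h3 (h2.antisymm h1.1 hc.1 hp.1)).elim⟩
  obtain ⟨v, -, hvl, hv⟩ := F.exists_node
    (P := fun x => ∃ q, Leftmost F g₀ g₁ p q ∧ x < F.fst q ∧ E x (F.snd q)) frame_auto_dfn d
  have hqv : ∀ q, Leftmost F g₀ g₁ p q → F.IsExt q v := by
    intro q hq
    have hqd := hcon q hq.1 hq.2.1
    refine ⟨hvl.symm ▸ hqd.le, fun x hx => ?_⟩
    rw [hv x (hx.trans hqd)]
    refine ⟨fun h => ⟨q, hq, hx, h⟩, fun ⟨q', hq', hx', h'⟩ => ?_⟩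
    rcases Leftmost.total hS hp hq hq' with h | h
    · exact (h.2 x hx).2 h'
    · exact (h.2 x hx').1 h'
  rcases sup_start (F := F) (A := Leftmost F g₀ g₁ p) frame_auto_dfn (fun c hc => hc.1) hqv with ⟨w, hw, hm⟩ | ⟨w, hw, -, hm, hcf⟩
  · have hT := hS.start_mem w hw.1
    refine absurd (hm (g₀ w) ⟨hS.start₀ hw.1, hw.2.1.trans (hS.ext₀ w hT), ?_⟩).1
      (not_le.2 (hS.lt₀ hT))
    intro c hc hpc hcg hne
    by_cases hcw : c = w
    · subst hcw
      exact .refl F _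
    rcases hcg.total (hS.ext₀ w hT) with h | h
    · exact (hw.2.2 c hc hpc h hcw).trans (hS.ext₀ w hT)
    · rcases hS.step_start c w hw.1 hc h (Ne.symm hcw) with h' | h'
      · exact (hne (hcg.antisymm h'.1 hc.1 (hS.start₀ hw.1).1)).elim
      · exact (hS.inc₁ w hT (h'.trans hcg)).elim
  · have : Leftmost F g₀ g₁ p w := by
      refine ⟨hw, (hm p hl).1, fun c hc hpc hcw hne => ?_⟩
      obtain ⟨c', hc', hlt⟩ := hcf _ (hcw.lt_of_ne hc.1 hw.1 hne)
      refine (hc'.2.2 c hc hpc (hcw.of_le (hm c' hc').1 hlt.le) ?_).trans (hm c' hc').1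
      rintro rfl
      exact lt_irrefl _ hlt
    exact lt_irrefl _ (hm w this).2

theorem cond_tree (hS : F.Splitter T g₀ g₁) : F.Cond (tree F g₀ g₁) where
  dfn := by
    have hs : Dfn1 E 𝒳 (F.Start g₀ g₁) := start_dfn hS.dfn₀ hS.dfn₁
    unfold tree
    exact frame_auto_dfn
  node p hp := hp.1
  down := fun p q ⟨_, r, hr, hpr⟩ hq hqp => ⟨hq, r, hr, hqp.trans hpr⟩
  long := fun p ⟨_, r, hr, hpr⟩ d =>
    let ⟨q, hq, hrq, hd⟩ := hS.exists_long hr d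
    ⟨q, ⟨hq.1, q, hq, .refl F q⟩, hpr.trans hrq, hd⟩
  split := fun p ⟨_, r, hr, hpr⟩ => by
    have hT := hS.start_mem r hr
    have h0 := hS.start₀ hr
    have h1 := hS.start₁ hr
    exact ⟨g₀ r, g₁ r, ⟨h0.1, _, h0, .refl F _⟩, ⟨h1.1, _, h1, .refl F _⟩,
      hpr.trans (hS.ext₀ r hT), hpr.trans (hS.ext₁ r hT), hS.inc₀ r hT, hS.inc₁ r hT⟩
  lim p hp h := hS.tree_lim hp h

end Splitter

/-- The tree `T'` is generated by the splitting nodes `St` with chosen successors `g₀` and `g₁`. -/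
structure Fused (F : Frame E 𝒳) (T' St : α → Prop) (g₀ g₁ : α → α) : Prop where
  cond : F.Cond T'
  dfn : Dfn1 E 𝒳 St
  mem : ∀ p, St p → T' p
  exists_ext : ∀ p, T' p → ∃ r, St r ∧ F.IsExt p r
  start₀ : ∀ p, St p → St (g₀ p)
  start₁ : ∀ p, St p → St (g₁ p)
  ext₀ : ∀ p, St p → F.IsExt p (g₀ p)
  ext₁ : ∀ p, St p → F.IsExt p (g₁ p)
  step : ∀ p q, St p → St q → F.IsExt p q → p ≠ q → F.IsExt (g₀ p) q ∨ F.IsExt (g₁ p) q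
  exists_le : ∀ d, ∃ d', ∀ r, T' r → d' ≤ F.fst r → ∃ c, St c ∧ F.IsExt c r ∧ d ≤ F.fst c
  meet : ∀ r p, St r → St p → ¬ F.IsExt r p → ¬ F.IsExt p r → ∃ w, St w ∧ F.IsExt w r ∧
    F.IsExt w p ∧ (F.IsExt (g₀ w) r ∧ F.IsExt (g₁ w) p ∨ F.IsExt (g₁ w) r ∧ F.IsExt (g₀ w) p)

theorem Cond.fusion {T : α → Prop} (hT : F.Cond T) {R : α → α → α → Prop} (hR : Dfn3 E 𝒳 R)
    (h : ∀ p, T p → ∃ q₀ q₁, T q₀ ∧ T q₁ ∧ F.IsExt p q₀ ∧ F.IsExt p q₁ ∧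
      ¬ F.IsExt q₀ q₁ ∧ ¬ F.IsExt q₁ q₀ ∧ R p q₀ q₁) :
    ∃ T' St g₀ g₁, F.Fused T' St g₀ g₁ ∧ (∀ p, T' p → T p) ∧ ∀ p, St p → R p (g₀ p) (g₁ p) := by
  have hd := hT.dfn
  obtain ⟨G, hG, hG'⟩ := F.exists_choice (R := fun p z => T p → T (F.fst z) ∧ T (F.snd z) ∧
    F.IsExt p (F.fst z) ∧ F.IsExt p (F.snd z) ∧ ¬ F.IsExt (F.fst z) (F.snd z) ∧
      ¬ F.IsExt (F.snd z) (F.fst z) ∧ R p (F.fst z) (F.snd z)) frame_auto_dfn (by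
    intro p
    by_cases hp : T p
    · obtain ⟨q₀, q₁, h⟩ := h p hp
      exact ⟨F.pr q₀ q₁, fun _ => by simpa only [F.fst_pr, F.snd_pr] using h⟩
    · exact ⟨p, fun h => (hp h).elim⟩)
  have hS : F.Splitter T (fun p => F.fst (G p)) (fun p => F.snd (G p)) :=
    { cond := hT
      dfn₀ := frame_auto_dfn
      dfn₁ := frame_auto_dfn
      mem₀ := fun p hp => (hG' p hp).1
      mem₁ := fun p hp => (hG' p hp).2.1
      ext₀ := fun p hp => (hG' p hp).2.2.1
      ext₁ := fun p hp => (hG' p hp).2.2.2.1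
      inc₀ := fun p hp => (hG' p hp).2.2.2.2.1
      inc₁ := fun p hp => (hG' p hp).2.2.2.2.2.1 }
  refine ⟨Splitter.tree F _ _, F.Start _ _, _, _, ⟨hS.cond_tree, start_dfn hS.dfn₀ hS.dfn₁,
    fun p hp => ⟨hp.1, p, hp, .refl F p⟩, fun p hp => hp.2, fun p => hS.start₀, fun p => hS.start₁,
    fun p hp => hS.ext₀ p (hS.start_mem p hp), fun p hp => hS.ext₁ p (hS.start_mem p hp),
    fun p q => hS.step_start q p, hS.exists_start_le, fun r p hr hp h1 h2 => ?_⟩,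
    fun p ⟨hp, r, hr, hpr⟩ => hT.down r p (hS.start_mem r hr) hp hpr,
    fun p hp => (hG' p (hS.start_mem p hp)).2.2.2.2.2.2⟩
  obtain ⟨w, hw, hwr, hwp, -, h⟩ := hS.meet hr hp h1 h2
  exact ⟨w, hw, hwr, hwp, h⟩

end Frame

end Nodes

section Deciding

variable {α : Type} {E : α → α → Prop} {𝒳 : Set (Set α)} [LinearOrder α]

namespace Frame

/-- `p` is an initial segment of the class `C`. -/
def OnClass (F : Frame E 𝒳) (p : α) (C : Set α) : Prop :=
  ∀ x, x < F.fst p → (E x (F.snd p) ↔ x ∈ C)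

/-- `C` is a branch of the tree `T`. -/
def Branch (F : Frame E 𝒳) (T : α → Prop) (C : Set α) : Prop :=
  ∀ a, ∃ p, T p ∧ a ≤ F.fst p ∧ F.OnClass p C

variable {F : Frame E 𝒳} {T T' : α → Prop} {p q r : α} {C : Set α}

theorem OnClass.of_isExt (h : F.OnClass q C) (h' : F.IsExt p q) : F.OnClass p C :=
  fun x hx => (h'.2 x hx).trans (h x (hx.trans_le h'.1))

theorem OnClass.isExt (h : F.OnClass p C) (h' : F.OnClass q C) (hl : F.fst p ≤ F.fst q) :
    F.IsExt p q :=
  ⟨hl, fun x hx => (h x hx).trans (h' x (hx.trans_le hl)).symm⟩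

theorem Branch.mono (h : F.Branch T C) (hT : ∀ p, T p → T' p) : F.Branch T' C := fun a =>
  let ⟨p, hp, h'⟩ := h a
  ⟨p, hT p hp, h'⟩

theorem Branch.exists_ext (h : F.Branch T C) (hp : F.OnClass p C) (hq : F.OnClass q C) :
    ∃ r, T r ∧ F.OnClass r C ∧ F.IsExt p r ∧ F.IsExt q r := by
  obtain ⟨r, hr, hl, hC⟩ := h (max (F.fst p) (F.fst q))
  exact ⟨r, hr, hC, hp.isExt hC ((le_max_left _ _).trans hl),
    hq.isExt hC ((le_max_right _ _).trans hl)⟩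

/-- The part of the tree `T` compatible with the node `p`. -/
def below (F : Frame E 𝒳) (T : α → Prop) (p q : α) : Prop :=
  T q ∧ (F.IsExt q p ∨ F.IsExt p q)

theorem Cond.below (hT : F.Cond T) (hp : T p) : F.Cond (F.below T p) where
  dfn := by
    have := hT.dfn
    unfold Frame.below
    exact frame_auto_dfn
  node q hq := hT.node q hq.1
  down := fun q r ⟨hq, h⟩ hr hrq => by
    refine ⟨hT.down q r hq hr hrq, ?_⟩
    rcases h with h | h
    · exact .inl (hrq.trans h)
    · exact hrq.total h
  long := fun q ⟨hq, h⟩ d => by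
    rcases h with h | h
    · obtain ⟨r, hr, hpr, hd⟩ := hT.long p hp d
      exact ⟨r, ⟨hr, .inr hpr⟩, h.trans hpr, hd⟩
    · obtain ⟨r, hr, hqr, hd⟩ := hT.long q hq d
      exact ⟨r, ⟨hr, .inr (h.trans hqr)⟩, hqr, hd⟩
  split := fun q ⟨hq, h⟩ => by
    rcases h with h | h
    · obtain ⟨r₀, r₁, h0, h1, h2, h3, h4⟩ := hT.split p hp
      exact ⟨r₀, r₁, ⟨h0, .inr h2⟩, ⟨h1, .inr h3⟩, h.trans h2, h.trans h3, h4⟩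
    · obtain ⟨r₀, r₁, h0, h1, h2, h3, h4⟩ := hT.split q hq
      exact ⟨r₀, r₁, ⟨h0, .inr (h.trans h2)⟩, ⟨h1, .inr (h.trans h3)⟩, h2, h3, h4⟩
  lim := fun r hr h => by
    refine ⟨hT.lim r hr fun d hd => ?_, ?_⟩
    · obtain ⟨q, hq, h'⟩ := h d hd
      exact ⟨q, hq.1, h'⟩
    · rcases le_or_gt (F.fst r) (F.fst p) with hl | hl
      · refine .inl ⟨hl, fun x hx => ?_⟩
        obtain ⟨q, ⟨-, hq⟩, hqr, hxq, hql⟩ := h x hx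
        rcases hq with hq | hq
        · rw [← hqr.2 x hxq, hq.2 x hxq]
        · exact absurd hq.1 (not_le.2 (hql.trans_le hl))
      · obtain ⟨q, ⟨-, hq⟩, hqr, hxq, hql⟩ := h _ hl
        rcases hq with hq | hq
        · exact absurd hq.1 (not_le.2 hxq)
        · exact .inr (hq.trans hqr)

theorem Branch.onClass (hT : F.Cond T) (hp : T p) (h : F.Branch (F.below T p) C) :
    F.OnClass p C := by
  obtain ⟨q, ⟨hq, hqp | hpq⟩, hl, hC⟩ := h (F.fst p)
  · exact hqp.antisymm hl (hT.node q hq) (hT.node p hp) ▸ hC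
  · exact hC.of_isExt hpq

/-- `r` decides `Q · x` on the tree `T`. -/
def Dec (F : Frame E 𝒳) (T : α → Prop) (Q : α → α → Prop) (r x : α) : Prop :=
  Q r x ∨ ∀ q, T q → F.IsExt r q → ¬ Q q x

theorem Dec.mono {Q : α → α → Prop} (hup : ∀ p q x, T p → T q → F.IsExt p q → Q p x → Q q x)
    (hp : T p) (hq : T q) (hpq : F.IsExt p q) {x : α} (h : F.Dec T Q p x) : F.Dec T Q q x :=
  h.imp (hup p q x hp hq hpq) fun h r hr hqr => h r hr (hpq.trans hqr)

theorem Cond.decide (hT : F.Cond T) {Q : α → α → Prop} (hQ : Dfn2 E 𝒳 Q)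
    (hup : ∀ p q x, T p → T q → F.IsExt p q → Q p x → Q q x) :
    ∃ T', F.Cond T' ∧ (∀ p, T' p → T p) ∧
      ∀ b, ∃ d, ∀ r, T' r → d ≤ F.fst r → ∀ x < b, F.Dec T Q r x := by
  have hTd := hT.dfn
  have hD : Dfn2 E 𝒳 (F.Dec T Q) := by
    unfold Dec
    exact frame_auto_dfn
  have key : ∀ p, T p → ∃ q, T q ∧ F.IsExt p q ∧
      ∀ x, (∀ y < x, F.Dec T Q p y) → F.Dec T Q q x := by
    intro p hp
    by_cases hx : ∃ x, ¬ F.Dec T Q p x ∧ ∀ y < x, F.Dec T Q p y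
    · obtain ⟨x, hx, hx'⟩ := hx
      obtain ⟨q, hq, hpq, hqx⟩ : ∃ q, T q ∧ F.IsExt p q ∧ Q q x := by
        by_contra! hcon
        exact hx (.inr hcon)
      refine ⟨q, hq, hpq, fun z hz => ?_⟩
      rcases lt_trichotomy z x with h | rfl | h
      · exact (hx' z h).mono hup hp hq hpq
      · exact .inl hqx
      · exact (hx (hz x h)).elim
    · push Not at hx
      refine ⟨p, hp, .refl F p, fun z hz => ?_⟩
      by_contra hcon
      obtain ⟨y, hy, hy'⟩ := hx z hcon
      exact hy' (hz y hy)
  obtain ⟨T', St, g₀, g₁, hF, hsub, hR⟩ := hT.fusion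
    (R := fun p q₀ q₁ => ∀ x, (∀ y, y < x → F.Dec T Q p y) → F.Dec T Q q₀ x ∧ F.Dec T Q q₁ x)
    frame_auto_dfn (by
      intro p hp
      obtain ⟨q₀, q₁, h0, h1, hp0, hp1, hi0, hi1⟩ := hT.split p hp
      obtain ⟨r₀, h0', hr0, hd0⟩ := key q₀ h0
      obtain ⟨r₁, h1', hr1, hd1⟩ := key q₁ h1
      refine ⟨r₀, r₁, h0', h1', hp0.trans hr0, hp1.trans hr1, fun h => ?_, fun h => ?_,
        fun x hx => ⟨hd0 x fun y hy => (hx y hy).mono hup hp h0 hp0,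
          hd1 x fun y hy => (hx y hy).mono hup hp h1 hp1⟩⟩
      · exact ((hr0.trans h).total hr1).elim hi0 hi1
      · exact ((hr1.trans h).total hr0).elim hi1 hi0)
  have hT'd := hF.cond.dfn
  refine ⟨T', hF.cond, hsub, ?_⟩
  have hW : ∀ x, ∃ d, ∀ r, T' r → d ≤ F.fst r → F.Dec T Q r x := by
    refine F.induction frame_auto_dfn fun x ih => ?_
    obtain ⟨e, he⟩ := F.coll (R := fun y d => ∀ r, T' r → d ≤ F.fst r → F.Dec T Q r y)
      frame_auto_dfn x ih
    obtain ⟨d, hd⟩ := hF.exists_le e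
    obtain ⟨d', hd'⟩ := F.nomax d
    obtain ⟨d'', hd''⟩ := hF.exists_le d'
    refine ⟨max d d'', fun r hr hl => ?_⟩
    obtain ⟨s, hs, rfl, hsr⟩ := F.exists_restrict r ((le_max_left _ _).trans hl)
    obtain ⟨c, hc, hcs, hec⟩ := hd s (hF.cond.down r s hr hs hsr) le_rfl
    obtain ⟨c', hc', hcr', hdc'⟩ := hd'' r hr ((le_max_right _ _).trans hl)
    have hlt : F.fst c < F.fst c' := (hcs.1.trans_lt hd').trans_le hdc'
    have hcd := hR c hc x fun y hy =>
      let ⟨f, hf, hf'⟩ := he y hy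
      hf' c (hF.mem c hc) (hf.le.trans hec)
    have hcc' := (hcs.trans hsr).of_le hcr' hlt.le
    rcases hF.step c c' hc hc' hcc' (by rintro rfl; exact lt_irrefl _ hlt) with h | h
    · exact hcd.1.mono hup (hsub _ (hF.mem _ (hF.start₀ c hc))) (hsub r hr) (h.trans hcr')
    · exact hcd.2.mono hup (hsub _ (hF.mem _ (hF.start₁ c hc))) (hsub r hr) (h.trans hcr')
  intro b
  obtain ⟨d, hd⟩ := F.coll (R := fun y d => ∀ r, T' r → d ≤ F.fst r → F.Dec T Q r y)
    frame_auto_dfn b fun x _ => hW x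
  refine ⟨d, fun r hr hl x hx => ?_⟩
  obtain ⟨e, he, he'⟩ := hd x hx
  exact he' r hr (he.le.trans hl)

/-- Nodes of `T` satisfying `Sp` or `Sn` force the truth or the falsity of `P` on branches. -/
structure Cont {σ : Type} (F : Frame E 𝒳) (T : α → Prop) (P : σ → Set α → Prop)
    (Sp Sn : α → σ → Prop) : Prop where
  upp : ∀ p q s, T p → T q → F.IsExt p q → Sp p s → Sp q s
  upn : ∀ p q s, T p → T q → F.IsExt p q → Sn p s → Sn q s
  cons : ∀ p s, T p → Sp p s → ¬ Sn p s
  soundp : ∀ C p s, F.Branch T C → T p → F.OnClass p C → Sp p s → P s C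
  soundn : ∀ C p s, F.Branch T C → T p → F.OnClass p C → Sn p s → ¬ P s C
  total : ∀ C s, F.Branch T C → ∃ p, T p ∧ F.OnClass p C ∧ (Sp p s ∨ Sn p s)

namespace Cont

variable {σ : Type} {P : σ → Set α → Prop} {Sp Sn : α → σ → Prop}

theorem mono (h : F.Cont T P Sp Sn) (hT : ∀ p, T' p → T p) :
    F.Cont T' P Sp Sn where
  upp p q s hp hq := h.upp p q s (hT p hp) (hT q hq)
  upn p q s hp hq := h.upn p q s (hT p hp) (hT q hq)
  cons p s hp := h.cons p s (hT p hp)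
  soundp C p s hC hp := h.soundp C p s (hC.mono hT) (hT p hp)
  soundn C p s hC hp := h.soundn C p s (hC.mono hT) (hT p hp)
  total C s hC := by
    obtain ⟨p, hp, hpC, h'⟩ := h.total C s (hC.mono hT)
    obtain ⟨q, hq, hqC, hpq, -⟩ := hC.exists_ext hpC hpC
    exact ⟨q, hq, hqC, h'.imp (h.upp p q s hp (hT q hq) hpq) (h.upn p q s hp (hT q hq) hpq)⟩

theorem comp {τ : Type} (h : F.Cont T P Sp Sn) (f : τ → σ) :
    F.Cont T (fun t => P (f t)) (fun p t => Sp p (f t)) fun p t => Sn p (f t) where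
  upp p q s := h.upp p q (f s)
  upn p q s := h.upn p q (f s)
  cons p s := h.cons p (f s)
  soundp C p s := h.soundp C p (f s)
  soundn C p s := h.soundn C p (f s)
  total C s := h.total C (f s)

theorem const (F : Frame E 𝒳) (T : α → Prop) (P : σ → Prop) :
    F.Cont T (fun s _ => P s) (fun _ s => P s) fun _ s => ¬ P s where
  upp p q s _ _ _ h := h
  upn p q s _ _ _ h := h
  cons p s _ h h' := h' h
  soundp C p s _ _ _ h := h
  soundn C p s _ _ _ h := h
  total C s hC := by
    obtain ⟨a⟩ := F.params.nonempty
    obtain ⟨p, hp, -, hpC⟩ := hC a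
    exact ⟨p, hp, hpC, em _⟩

theorem mem (F : Frame E 𝒳) (T : α → Prop) (f : σ → α) :
    F.Cont T (fun s C => f s ∈ C) (fun p s => f s < F.fst p ∧ E (f s) (F.snd p))
      fun p s => f s < F.fst p ∧ ¬ E (f s) (F.snd p) where
  upp p q s _ _ h h' := ⟨h'.1.trans_le h.1, (h.2 _ h'.1).1 h'.2⟩
  upn p q s _ _ h h' := ⟨h'.1.trans_le h.1, fun h'' => h'.2 ((h.2 _ h'.1).2 h'')⟩
  cons p s _ h h' := h'.2 h.2
  soundp C p s _ _ hC h := (hC _ h.1).1 h.2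
  soundn C p s _ _ hC h h' := h.2 ((hC _ h.1).2 h')
  total C s hC := by
    obtain ⟨b, hb⟩ := F.nomax (f s)
    obtain ⟨p, hp, hl, hpC⟩ := hC b
    refine ⟨p, hp, hpC, ?_⟩
    have := hb.trans_le hl
    tauto

theorem imp {P' : σ → Set α → Prop} {Sp' Sn' : α → σ → Prop} (h : F.Cont T P Sp Sn)
    (h' : F.Cont T P' Sp' Sn') : F.Cont T (fun s C => P s C → P' s C)
      (fun p s => Sn p s ∨ Sp' p s) fun p s => Sp p s ∧ Sn' p s where
  upp p q s hp hq hpq := Or.imp (h.upn p q s hp hq hpq) (h'.upp p q s hp hq hpq)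
  upn p q s hp hq hpq := And.imp (h.upp p q s hp hq hpq) (h'.upn p q s hp hq hpq)
  cons p s hp := by
    have := h.cons p s hp
    have := h'.cons p s hp
    tauto
  soundp C p s hC hp hpC hs := by
    have := h.soundn C p s hC hp hpC
    have := h'.soundp C p s hC hp hpC
    tauto
  soundn C p s hC hp hpC hs := by
    have := h.soundp C p s hC hp hpC
    have := h'.soundn C p s hC hp hpC
    tauto
  total C s hC := by
    obtain ⟨p, hp, hpC, h1⟩ := h.total C s hC
    obtain ⟨q, hq, hqC, h2⟩ := h'.total C s hC
    obtain ⟨r, hr, hrC, hpr, hqr⟩ := hC.exists_ext hpC hqC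
    refine ⟨r, hr, hrC, ?_⟩
    have := h.upp p r s hp hr hpr
    have := h.upn p r s hp hr hpr
    have := h'.upp q r s hq hr hqr
    have := h'.upn q r s hq hr hqr
    tauto

end Cont

/-- The `k`-th entry of the finite sequence coded by `x`. -/
def entry (F : Frame E 𝒳) : ℕ → α → α
  | 0, x => F.fst x
  | k + 1, x => F.entry k (F.snd x)

theorem entry_dfn (F : Frame E 𝒳) (k : ℕ) : DfnF1 E 𝒳 (F.entry k) := by
  induction k with
  | zero => exact F.fst_dfn
  | succ k ih =>
    change DfnF1 E 𝒳 fun x => F.entry k (F.snd x)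
    exact frame_auto_dfn

theorem exists_entry (F : Frame E 𝒳) (N : ℕ) (s : ℕ → α) : ∃ x, ∀ k < N, F.entry k x = s k := by
  induction N generalizing s with
  | zero => exact ⟨s 0, by simp⟩
  | succ N ih =>
    obtain ⟨x, hx⟩ := ih fun n => s (n + 1)
    refine ⟨F.pr (s 0) x, fun k hk => ?_⟩
    rcases k with _ | k
    · exact F.fst_pr _ _
    · rw [entry, F.snd_pr]
      exact hx k (by omega)

theorem Cond.exists_cont_all (hT : F.Cond T) {P : (ℕ → α) → Set α → Prop}
    {Sp Sn : α → (ℕ → α) → Prop} (h : F.Cont T P Sp Sn)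
    (hn : Dfn E 𝒳 fun s => Sn (s 0) fun n => s (n + 1)) (i : ℕ) :
    ∃ T', F.Cond T' ∧ (∀ p, T' p → T p) ∧ ∃ Sp' Sn' : α → (ℕ → α) → Prop,
      F.Cont T' (fun s C => ∀ x, P (Function.update s i x) C) Sp' Sn' ∧
      (Dfn E 𝒳 fun s => Sp' (s 0) fun n => s (n + 1)) ∧
      Dfn E 𝒳 fun s => Sn' (s 0) fun n => s (n + 1) := by
  have := F.params
  have hTd := hT.dfn
  let Sn' : α → (ℕ → α) → Prop := fun p s => ∃ y, Sn p (Function.update s i y)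
  have hn' : Dfn E 𝒳 fun s => Sn' (s 0) fun n => s (n + 1) := by
    refine .ex (P := fun y s => Sn (s 0) (Function.update (fun n => s (n + 1)) i y)) ?_
    refine (hn.comp (f := fun k s => if k = 0 then s 1 else if k = i + 1 then s 0 else s (k + 1))
      fun k => ?_).congr fun s => ?_
    · split_ifs <;> exact .var _
    · simp only [↓reduceIte, Nat.add_eq_zero_iff, one_ne_zero, and_false, add_left_inj]
      apply iff_of_eq
      congr 1
      funext n
      simp [Function.update_apply]
  have hnc : ∀ {f : (ℕ → α) → α} {g : ℕ → (ℕ → α) → α}, DfnF E 𝒳 f → (∀ n, DfnF E 𝒳 (g n)) →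
      Dfn E 𝒳 fun s => Sn' (f s) fun n => g n s := fun {f g} hf hg =>
    hn'.comp (f := fun k s => Nat.casesOn k (f s) fun n => g n s) fun k => by
      cases k
      exacts [hf, hg _]
  have hup : ∀ p q s, T p → T q → F.IsExt p q → Sn' p s → Sn' q s :=
    fun p q s hp hq hpq ⟨y, hy⟩ => ⟨y, h.upn p q _ hp hq hpq hy⟩
  obtain ⟨N, hN⟩ := hn'.support
  have hN' : ∀ p s s', (∀ k < N, s k = s' k) → (Sn' p s ↔ Sn' p s') := fun p s s' hs =>
    hN (fun k => Nat.casesOn k p s) (fun k => Nat.casesOn k p s') fun k hk => by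
      cases k
      exacts [rfl, hs _ (by omega)]
  obtain ⟨T', hT', hsub, hdec⟩ := hT.decide (Q := fun p x => Sn' p fun k => F.entry k x)
    ⟨hnc (.var 0) fun n => .comp1 (F.entry_dfn n) (.var 1)⟩ fun p q x => hup p q _
  refine ⟨T', hT', hsub, fun p s => ∀ q, T q → F.IsExt p q → ¬ Sn' q s, Sn',
    ⟨fun p q s _ _ hpq h r hr hqr => h r hr (hpq.trans hqr),
      fun p q s hp hq => hup p q s (hsub p hp) (hsub q hq),
      fun p s hp h => h p (hsub p hp) (.refl F p), fun C p s hC hp hpC hs x => ?_,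
      fun C p s hC hp hpC ⟨y, hy⟩ h' => h.soundn C p _ (hC.mono hsub) (hsub p hp) hpC hy (h' y),
      fun C s hC => ?_⟩, ?_, hn'⟩
  · have hC' := hC.mono hsub
    obtain ⟨q, hq, hqC, hqs | hqs⟩ := h.total C (Function.update s i x) hC'
    · exact h.soundp C q _ hC' hq hqC hqs
    · obtain ⟨r, hr, hrC, hpr, hqr⟩ := hC'.exists_ext hpC hqC
      exact (hs r hr hpr ⟨x, h.upn q r _ hq hr hqr hqs⟩).elim
  · obtain ⟨x, hx⟩ := F.exists_entry N s
    obtain ⟨b, hb⟩ := F.nomax x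
    obtain ⟨d, hd⟩ := hdec b
    obtain ⟨p, hp, hl, hpC⟩ := hC d
    refine ⟨p, hp, hpC, (hd p hp hl x hb).symm.imp (fun h q hq hpq hs => ?_) fun h => ?_⟩
    · exact h q hq hpq ((hN' q _ _ hx).2 hs)
    · exact (hN' p _ _ hx).1 h
  · refine .all (P := fun q s => T q → F.IsExt (s 0) q → ¬ Sn' q fun n => s (n + 1)) ?_
    exact (Dfn.comp1 hTd (.var 0)).imp ((Dfn.comp2 F.isExt_dfn (.var 1) (.var 0)).imp
      (hnc (.var 0) fun n => .var (n + 2)).not)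

theorem Cond.exists_cont (hT : F.Cond T) {φ : Fml} (e : φ.IsElementary)
    {cl : ℕ → Set α → Set α} (hcl : ∀ n, (∃ X ∈ 𝒳, ∀ C, cl n C = X) ∨ ∀ C, cl n C = C) :
    ∃ T', F.Cond T' ∧ (∀ p, T' p → T p) ∧ ∃ Sp Sn : α → (ℕ → α) → Prop,
      F.Cont T' (fun s C => Tr E φ s fun n => cl n C) Sp Sn ∧
      (Dfn E 𝒳 fun s => Sp (s 0) fun n => s (n + 1)) ∧
      Dfn E 𝒳 fun s => Sn (s 0) fun n => s (n + 1) := by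
  have := F.params
  have hlt := F.lt_dfn
  have hf := F.fst_dfn
  have hs := F.snd_dfn
  induction φ generalizing T with
  | memSS i j =>
    exact ⟨T, hT, fun p h => h, _, _, .const F T fun s : ℕ → α => E (s i) (s j), auto_dfn, auto_dfn⟩
  | eqS i j =>
    exact ⟨T, hT, fun p h => h, _, _, .const F T fun s : ℕ → α => s i = s j, auto_dfn, auto_dfn⟩
  | fal => exact ⟨T, hT, fun p h => h, _, _, .const F T fun s : ℕ → α => False, auto_dfn, auto_dfn⟩
  | memSC i j =>
    rcases hcl j with ⟨X, hX, hc⟩ | hc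
    · refine ⟨T, hT, fun p h => h, fun _ s => s i ∈ X, fun _ s => s i ∉ X, ?_, .classVar (i + 1) hX, (Dfn.classVar (i + 1) hX).not⟩
      simp only [Tr, Sat, hc]
      exact .const F T fun s : ℕ → α => s i ∈ X
    · refine ⟨T, hT, fun p h => h, fun p s => s i < F.fst p ∧ E (s i) (F.snd p),
        fun p s => s i < F.fst p ∧ ¬ E (s i) (F.snd p), ?_, auto_dfn, auto_dfn⟩
      simp only [Tr, Sat, hc]
      exact .mem F T fun s : ℕ → α => s i
  | imp φ ψ ih₁ ih₂ =>
    obtain ⟨T₁, hT₁, hs₁, Sp, Sn, h₁, hp, hn⟩ := ih₁ hT e.1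
    obtain ⟨T₂, hT₂, hs₂, Sp', Sn', h₂, hp', hn'⟩ := ih₂ hT₁ e.2
    exact ⟨T₂, hT₂, fun p h => hs₁ p (hs₂ p h), _, _, (h₁.mono hs₂).imp h₂, hn.or hp',
      hp.and hn'⟩
  | allS i φ ih =>
    obtain ⟨T₁, hT₁, hs₁, Sp, Sn, h₁, -, hn⟩ := ih hT e
    obtain ⟨T₂, hT₂, hs₂, Sp', Sn', h₂, hp', hn'⟩ := hT₁.exists_cont_all h₁ hn i
    refine ⟨T₂, hT₂, fun p h => hs₁ p (hs₂ p h), Sp', Sn', ?_, hp', hn'⟩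
    simpa only [Tr, Sat, Set.mem_univ, forall_const] using h₂
  | allC i φ ih => exact e.elim

theorem Cond.exists_functional (hT : F.Cond T) {P : α × α → Set α → Prop} {Sp Sn : α → α → α → Prop}
    (h : F.Cont T P (fun p z => Sp p z.1 z.2) fun p z => Sn p z.1 z.2) (hp : Dfn3 E 𝒳 Sp) :
    ∃ T', F.Cond T' ∧ (∀ p, T' p → T p) ∧ ∀ C, F.Branch T' C →
      (∀ x y y', P (x, y) C → P (x, y') C → y = y') →
        ∀ a, ∃ b, ∀ y, E y b ↔ ∃ x, E x a ∧ P (x, y) C := by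
  obtain ⟨T', hT', hsub, hdec⟩ := hT.decide (Q := fun p x => ∃ y, Sp p x y) frame_auto_dfn
    fun p q x hp hq hpq ⟨y, hy⟩ => ⟨y, h.upp p q (x, y) hp hq hpq hy⟩
  refine ⟨T', hT', hsub, fun C hC hfun a => ?_⟩
  have hC' := hC.mono hsub
  obtain ⟨c, hc⟩ := F.bdd a
  obtain ⟨d, hd⟩ := hdec c
  obtain ⟨p, hpT, hl, hpC⟩ := hC d
  have hsound : ∀ x y, Sp p x y → P (x, y) C := fun x y =>
    h.soundp C p (x, y) hC' (hsub p hpT) hpC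
  obtain ⟨b, hb⟩ := F.repl (R := fun x y => Sp p x y) frame_auto_dfn
    (fun x y y' h1 h2 => hfun x y y' (hsound _ _ h1) (hsound _ _ h2)) a
  refine ⟨b, fun y => (hb y).trans (exists_congr fun x => and_congr_right fun hx =>
    ⟨hsound x y, fun hxy => ?_⟩)⟩
  rcases hd p hpT hl x (hc x hx) with ⟨y', hy'⟩ | hno
  · exact hfun x y y' hxy (hsound x y' hy') ▸ hy'
  · obtain ⟨q, hq, hqC, hqs | hqs⟩ := h.total C (x, y) hC'
    · obtain ⟨r, hr, hrC, hpr, hqr⟩ := hC'.exists_ext hpC hqC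
      exact (hno r hr hpr ⟨y, h.upp q r (x, y) hq hr hqr hqs⟩).elim
    · exact (h.soundn C q (x, y) hC' hq hqC hqs hxy).elim

theorem Cond.exists_constant_or (hT : F.Cond T) {P : α → Set α → Prop} {Sp Sn : α → α → Prop}
    (h : F.Cont T P Sp Sn) (hp : Dfn2 E 𝒳 Sp) (hn : Dfn2 E 𝒳 Sn) :
    ∃ T', F.Cond T' ∧ (∀ p, T' p → T p) ∧
      ((∃ X ∈ 𝒳, ∀ C, F.Branch T' C → {x | P x C} = X) ∨
        ∀ C, F.Branch T' C → Dfn1 E (insert {x | P x C} 𝒳) fun x => x ∈ C) := by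
  have hTd := hT.dfn
  by_cases hcase : ∃ p, T p ∧ ∀ q₀ q₁, T q₀ → T q₁ → F.IsExt p q₀ → F.IsExt p q₁ →
      ∀ x, Sp q₀ x → ¬ Sn q₁ x
  · obtain ⟨p, hpT, hno⟩ := hcase
    refine ⟨_, hT.below hpT, fun q hq => hq.1,
      .inl ⟨{x | ∃ q, T q ∧ F.IsExt p q ∧ Sp q x}, F.compr frame_auto_dfn, fun C hC => ?_⟩⟩
    have hpC := Branch.onClass hT hpT hC
    have hC' := hC.mono fun q hq => hq.1
    ext x
    simp only [Set.mem_ofPred_eq]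
    obtain ⟨q, hq, hqC, hqs⟩ := h.total C x hC'
    obtain ⟨r, hr, hrC, hpr, hqr⟩ := hC'.exists_ext hpC hqC
    constructor
    · intro hx
      refine ⟨r, hr, hpr, h.upp q r x hq hr hqr (hqs.resolve_right fun hs => ?_)⟩
      exact h.soundn C q x hC' hq hqC hs hx
    · rintro ⟨q', hq', hpq', hs⟩
      refine h.soundp C q x hC' hq hqC (hqs.resolve_right fun hs' => ?_)
      exact hno q' r hq' hr hpq' hpr x hs (h.upn q r x hq hr hqr hs')
  · push Not at hcase
    obtain ⟨T', St, g₀, g₁, hF, hsub, hR⟩ := hT.fusion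
      (R := fun p q₀ q₁ => ∃ x, Sp q₀ x ∧ Sn q₁ x) frame_auto_dfn (by
        intro p hp
        obtain ⟨q₀, q₁, h0, h1, hp0, hp1, x, hx0, hx1⟩ := hcase p hp
        refine ⟨q₀, q₁, h0, h1, hp0, hp1, fun h' => ?_, fun h' => ?_, x, hx0, hx1⟩
        · exact h.cons q₁ x h1 (h.upp _ _ x h0 h1 h' hx0) hx1
        · exact h.cons q₀ x h0 hx0 (h.upn _ _ x h1 h0 h' hx1))
    refine ⟨T', hF.cond, hsub, .inr fun C hC => ?_⟩
    have hC' := hC.mono hsub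
    set Y := {x | P x C} with hY
    have hlong : ∀ a, ∃ c, St c ∧ F.OnClass c C ∧ a ≤ F.fst c := by
      intro a
      obtain ⟨d, hd⟩ := hF.exists_le a
      obtain ⟨p, hp, hl, hpC⟩ := hC d
      obtain ⟨c, hc, hcp, hac⟩ := hd p hp hl
      exact ⟨c, hc, hpC.of_isExt hcp, hac⟩
    have hSt : ∀ c, St c → T c := fun c hc => hsub c (hF.mem c hc)
    have hsoundp : ∀ c x, St c → F.OnClass c C → Sp c x → x ∈ Y := fun c x hc hcC =>
      h.soundp C c x hC' (hSt c hc) hcC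
    have hsoundn : ∀ c x, St c → F.OnClass c C → Sn c x → x ∉ Y := fun c x hc hcC =>
      h.soundn C c x hC' (hSt c hc) hcC
    have hiff : ∀ x, x ∈ C ↔ ∃ r, St r ∧ x < F.fst r ∧ E x (F.snd r) ∧
        ∀ z, (Sp r z → z ∈ Y) ∧ (Sn r z → z ∉ Y) := by
      intro x
      constructor
      · intro hx
        obtain ⟨b, hb⟩ := F.nomax x
        obtain ⟨c, hc, hcC, hl⟩ := hlong b
        have hxc := hb.trans_le hl
        exact ⟨c, hc, hxc, (hcC x hxc).2 hx, fun z => ⟨hsoundp c z hc hcC, hsoundn c z hc hcC⟩⟩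
      · rintro ⟨r, hr, hxr, hx, hz⟩
        suffices F.OnClass r C from (this x hxr).1 hx
        obtain ⟨p, hp, hpC, hl⟩ := hlong (F.fst r)
        by_cases hrp : F.IsExt r p
        · exact hpC.of_isExt hrp
        by_cases hpr : F.IsExt p r
        · exact hpr.antisymm hl (hT.node p (hSt p hp)) (hT.node r (hSt r hr)) ▸ hpC
        obtain ⟨w, hw, -, -, h'⟩ := hF.meet r p hr hp hrp hpr
        obtain ⟨z, hz0, hz1⟩ := hR w hw
        have hw0 := hSt _ (hF.start₀ w hw)
        have hw1 := hSt _ (hF.start₁ w hw)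
        exfalso
        rcases h' with ⟨h0, h1⟩ | ⟨h1, h0⟩
        · exact hsoundn p z hp hpC (h.upn _ p z hw1 (hSt p hp) h1 hz1)
            ((hz z).1 (h.upp _ r z hw0 (hSt r hr) h0 hz0))
        · exact (hz z).2 (h.upn _ r z hw1 (hSt r hr) h1 hz1)
            (hsoundp p z hp hpC (h.upp _ p z hw0 (hSt p hp) h0 hz0))
    have hsub' : 𝒳 ⊆ insert Y 𝒳 := Set.subset_insert _ _
    have : Params (insert Y 𝒳) := by
      have := F.params
      exact Params.mono hsub'
    have h1 : Dfn1 E (insert Y 𝒳) St := ⟨hF.dfn.out.mono hsub'⟩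
    have h2 : Dfn2 E (insert Y 𝒳) fun a b => a < b := ⟨F.lt_dfn.out.mono hsub'⟩
    have h3 : DfnF1 E (insert Y 𝒳) F.fst := ⟨⟨F.fst_dfn.out.out.mono hsub'⟩⟩
    have h4 : DfnF1 E (insert Y 𝒳) F.snd := ⟨⟨F.snd_dfn.out.out.mono hsub'⟩⟩
    have h5 : Dfn2 E (insert Y 𝒳) Sp := ⟨hp.out.mono hsub'⟩
    have h6 : Dfn2 E (insert Y 𝒳) Sn := ⟨hn.out.mono hsub'⟩
    have h7 : Dfn1 E (insert Y 𝒳) fun x => x ∈ Y := .of_mem (Set.mem_insert _ _)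
    refine ⟨Dfn.congr ?_ fun s => hiff (s 0)⟩
    exact auto_dfn

end Frame

end Deciding

section Generic

variable {α : Type} {E : α → α → Prop} {𝒳 : Set (Set α)}

namespace Frame

variable [LinearOrder α] {F : Frame E 𝒳}

theorem cond_node (F : Frame E 𝒳) : F.Cond F.Node := by
  have key : ∀ p d (P : α → Prop), Dfn1 E 𝒳 P → F.fst p ≤ d → ∃ q, F.Node q ∧ F.IsExt p q ∧
      F.fst q = d ∧ ∀ x, F.fst p ≤ x → x < d → (E x (F.snd q) ↔ P x) := by
    intro p d P hP hd
    obtain ⟨q, hq, rfl, h⟩ := F.exists_node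
      (P := fun x => x < F.fst p ∧ E x (F.snd p) ∨ ¬ x < F.fst p ∧ P x) frame_auto_dfn d
    refine ⟨q, hq, ⟨hd, fun x hx => ?_⟩, rfl, fun x hx hxd => ?_⟩
    · rw [h x (hx.trans_le hd)]
      tauto
    · rw [h x hxd]
      have := not_lt.2 hx
      tauto
  have := F.params
  refine ⟨F.node_dfn, fun p hp => hp, fun p q _ hq _ => hq, fun p _ d => ?_, fun p _ => ?_,
    fun p hp _ => hp⟩
  · obtain ⟨q, hq, hpq, hl, -⟩ := key p (max (F.fst p) d) (fun _ => True) auto_dfn (le_max_left _ _)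
    exact ⟨q, hq, hpq, hl ▸ le_max_right _ _⟩
  · obtain ⟨b, hb⟩ := F.nomax (F.fst p)
    obtain ⟨q₀, h0, hp0, rfl, hP0⟩ := key p b (fun _ => True) auto_dfn hb.le
    obtain ⟨q₁, h1, hp1, hl, hP1⟩ := key p (F.fst q₀) (fun _ => False) auto_dfn hb.le
    have e0 := hP0 _ le_rfl hb
    have e1 := hP1 _ le_rfl hb
    refine ⟨q₀, q₁, h0, h1, hp0, hp1, fun h => ?_, fun h => ?_⟩
    · exact e1.1 ((h.2 _ hb).1 (e0.2 trivial))
    · exact e1.1 ((h.2 _ (hl ▸ hb)).2 (e0.2 trivial))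

theorem Cond.exists_mem {T : α → Prop} (hT : F.Cond T) : ∃ p, T p := by
  have := F.params
  obtain ⟨a, ha⟩ := F.exists_least
  obtain ⟨p, hp, rfl, -⟩ := F.exists_node (P := fun _ => True) auto_dfn a
  exact ⟨p, hT.lim p hp fun d hd => (not_lt.2 (ha d) hd).elim⟩

theorem exists_generic (F : Frame E 𝒳) [Countable α] {ι : Type} [Countable ι] [Nonempty ι]
    (Req : ι → (α → Prop) → Prop)
    (hReq : ∀ i T, F.Cond T → ∃ T', F.Cond T' ∧ (∀ p, T' p → T p) ∧ Req i T') :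
    ∃ C, ∀ i, ∃ T, Req i T ∧ F.Branch T C := by
  have := F.params.nonempty
  obtain ⟨e, he⟩ := exists_surjective_nat ι
  obtain ⟨a, ha⟩ := exists_surjective_nat α
  have step : ∀ (n : ℕ) (x : {x : (α → Prop) × α // F.Cond x.1 ∧ x.1 x.2}),
      ∃ y : {x : (α → Prop) × α // F.Cond x.1 ∧ x.1 x.2}, Req (e n) y.1.1 ∧
        (∀ p, y.1.1 p → x.1.1 p) ∧ F.IsExt x.1.2 y.1.2 ∧ a n ≤ F.fst y.1.2 := by
    rintro n ⟨⟨T, p⟩, hT, hp⟩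
    obtain ⟨T', hT', hsub, hr⟩ := hReq (e n) _ (hT.below hp)
    obtain ⟨r, hrT⟩ := hT'.exists_mem
    obtain ⟨q, hq, -, hl⟩ := hT'.long r hrT (max (F.fst p) (a n))
    refine ⟨⟨(T', q), hT', hq⟩, hr, fun p hp => (hsub p hp).1, ?_, (le_max_right _ _).trans hl⟩
    rcases (hsub q hq).2 with h | h
    · have e : q = p := h.antisymm ((le_max_left _ _).trans hl) (hT'.node q hq) (hT.node p hp)
      change F.IsExt p q
      rw [e]
      exact .refl F p
    · exact h
  choose f hf using step
  obtain ⟨p₀, hp₀⟩ := F.cond_node.exists_mem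
  let x : ℕ → {x : (α → Prop) × α // F.Cond x.1 ∧ x.1 x.2} := fun n =>
    Nat.rec ⟨(F.Node, p₀), F.cond_node, hp₀⟩ (fun n x => f n x) n
  have hx : ∀ n, x (n + 1) = f n (x n) := fun n => rfl
  have hext : ∀ m n, m ≤ n → F.IsExt (x m).1.2 (x n).1.2 ∧ ∀ p, (x n).1.1 p → (x m).1.1 p := by
    intro m n hmn
    induction n, hmn using Nat.le_induction with
    | base => exact ⟨.refl F _, fun p hp => hp⟩
    | succ n _ ih =>
      rw [hx]
      exact ⟨ih.1.trans (hf n (x n)).2.2.1, fun p hp => ih.2 p ((hf n (x n)).2.1 p hp)⟩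
  let C : Set α := {y | ∃ n, y < F.fst (x n).1.2 ∧ E y (F.snd (x n).1.2)}
  have hC : ∀ n, F.OnClass (x n).1.2 C := by
    refine fun n y hy => ⟨fun h => ⟨n, hy, h⟩, fun ⟨m, hm, h⟩ => ?_⟩
    rcases le_total m n with hmn | hmn
    · exact ((hext m n hmn).1.2 y hm).1 h
    · exact ((hext n m hmn).1.2 y hy).2 h
  refine ⟨C, fun i => ?_⟩
  obtain ⟨n, rfl⟩ := he i
  refine ⟨(x (n + 1)).1.1, hx n ▸ (hf n (x n)).1, fun b => ?_⟩
  obtain ⟨m, rfl⟩ := ha b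
  refine ⟨(x (max m n + 1)).1.2,
    (hext (n + 1) (max m n + 1) (by omega)).2 _ (x (max m n + 1)).2.2, ?_, hC (max m n + 1)⟩
  have h1 := (hf m (x m)).2.2.2
  rw [← hx] at h1
  exact h1.trans (hext (m + 1) (max m n + 1) (by omega)).1.1

theorem Cond.exists_ne {T : α → Prop} (hT : F.Cond T) (X : Set α) :
    ∃ T', F.Cond T' ∧ (∀ p, T' p → T p) ∧ ∀ C, F.Branch T' C → C ≠ X := by
  obtain ⟨p, hp⟩ := hT.exists_mem
  obtain ⟨q₀, q₁, h0, h1, -, -, h01, h10⟩ := hT.split p hp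
  obtain ⟨q, hq, hqX⟩ : ∃ q, T q ∧ ¬ F.OnClass q X := by
    by_contra! hcon
    rcases le_total (F.fst q₀) (F.fst q₁) with hl | hl
    · exact h01 ((hcon q₀ h0).isExt (hcon q₁ h1) hl)
    · exact h10 ((hcon q₁ h1).isExt (hcon q₀ h0) hl)
  refine ⟨_, hT.below hq, fun r hr => hr.1, ?_⟩
  rintro C hC rfl
  exact hqX (Branch.onClass hT hq hC)

end Frame

theorem Fml.code_injective : Function.Injective Fml.code := by
  intro φ
  induction φ with
  | imp φ ψ ih₁ ih₂ =>
    rintro (_ | _ | _ | _ | _ | _ | _) h <;> simp [Fml.code] at h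
    exact congrArg₂ _ (ih₁ h.1) (ih₂ h.2)
  | allS i φ ih =>
    rintro (_ | _ | _ | _ | _ | _ | _) h <;> simp [Fml.code] at h
    exact congrArg₂ _ h.1 (ih h.2)
  | allC i φ ih =>
    rintro (_ | _ | _ | _ | _ | _ | _) h <;> simp [Fml.code] at h
    exact congrArg₂ _ h.1 (ih h.2)
  | _ => rintro (_ | _ | _ | _ | _ | _ | _) h <;> simp_all [Fml.code]

/-- The assignment of classes from `𝒳` coded by a finite list, with default value `C`. -/
def assign (L : List (Option 𝒳)) (n : ℕ) (C : Set α) : Set α :=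
  (L[n]?.join.map Subtype.val).getD C

/-- The binary predicate defined by a formula and a finite list of parameters. -/
def Holds (E : α → α → Prop) (i : Fml × List (Option 𝒳)) (x y : α) (C : Set α) : Prop :=
  Tr E i.1 (fun n => if n = 0 then x else y) fun n => assign i.2 n C

theorem Dfn2.exists_holds {C : Set α} {R : α → α → Prop} (hR : Dfn2 E (insert C 𝒳) R) :
    ∃ i : Fml × List (Option 𝒳), i.1.IsElementary ∧ ∀ x y, R x y ↔ Holds E i x y C := by
  classical
  obtain ⟨φ, e, c, hc, h⟩ := hR.out.out
  obtain ⟨K, hK⟩ := tr_support (α := α) e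
  refine ⟨(φ, (List.range K).map fun n => if h : c n ∈ 𝒳 then some ⟨c n, h⟩ else none), e,
    fun x y => (h fun n => if n = 0 then x else y).trans (hK E _ _ _ _ (fun _ _ => rfl) ?_)⟩
  intro n hn
  by_cases h' : c n ∈ 𝒳
  · simp [assign, hn, h']
  · simpa [assign, hn, h'] using (hc n).resolve_right h'

namespace Frame

variable [LinearOrder α] {F : Frame E 𝒳}

theorem Cond.exists_holds {T : α → Prop} (hT : F.Cond T) {i : Fml × List (Option 𝒳)}
    (e : i.1.IsElementary) : ∃ T', F.Cond T' ∧ (∀ p, T' p → T p) ∧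
      (∀ C, F.Branch T' C → (∀ x y y', Holds E i x y C → Holds E i x y' C → y = y') →
        ∀ a, ∃ b, ∀ y, E y b ↔ ∃ x, E x a ∧ Holds E i x y C) ∧
      ((∃ X ∈ 𝒳, ∀ C, F.Branch T' C → {x | Holds E i x x C} = X) ∨
        ∀ C, F.Branch T' C → Dfn1 E (insert {x | Holds E i x x C} 𝒳) fun x => x ∈ C) := by
  have := F.params
  obtain ⟨T₁, hT₁, hs₁, Sp, Sn, h₁, hp, hn⟩ := hT.exists_cont e (cl := assign i.2) (by
    intro n
    rcases h : i.2[n]? with _ | _ | X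
    · exact .inr fun C => by simp [assign, h]
    · exact .inr fun C => by simp [assign, h]
    · exact .inl ⟨X, X.2, fun C => by simp [assign, h]⟩)
  have key : ∀ {S : α → (ℕ → α) → Prop}, (Dfn E 𝒳 fun s => S (s 0) fun n => s (n + 1)) →
      Dfn3 E 𝒳 fun p x y => S p fun n => if n = 0 then x else y := fun hS =>
    ⟨(hS.comp (f := fun k s => if k = 0 then s 0 else if k = 1 then s 1 else s 2) fun k => by
      split_ifs <;> exact .var _).congr fun s => by simp⟩
  have hp' := key hp
  have hn' := key hn
  obtain ⟨T₂, hT₂, hs₂, hfun⟩ := hT₁.exists_functional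
    (Sp := fun p x y => Sp p fun n => if n = 0 then x else y)
    (Sn := fun p x y => Sn p fun n => if n = 0 then x else y)
    (h₁.comp fun (z : α × α) n => if n = 0 then z.1 else z.2) hp'
  obtain ⟨T₃, hT₃, hs₃, hor⟩ := hT₂.exists_constant_or
    ((h₁.mono hs₂).comp fun (x : α) n => if n = 0 then x else x)
    ⟨Dfn.comp3 hp' (.var 0) (.var 1) (.var 1)⟩ ⟨Dfn.comp3 hn' (.var 0) (.var 1) (.var 1)⟩
  exact ⟨T₃, hT₃, fun p h => hs₁ p (hs₂ p (hs₃ p h)), fun C hC => hfun C (hC.mono hs₃), hor⟩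

end Frame

theorem GBC.exists_minimal_generic [Countable α] (h𝒳 : 𝒳.Countable) (h : GBC Set.univ E 𝒳) :
    ∃ C, C ∉ 𝒳 ∧ ∀ i : Fml × List (Option 𝒳), i.1.IsElementary →
      ((∀ x y y', Holds E i x y C → Holds E i x y' C → y = y') →
        ∀ a, ∃ b, ∀ y, E y b ↔ ∃ x, E x a ∧ Holds E i x y C) ∧
      ({x | Holds E i x x C} ∈ 𝒳 ∨ Dfn1 E (insert {x | Holds E i x x C} 𝒳) fun x => x ∈ C) := by
  obtain ⟨_, ⟨F⟩⟩ := h.exists_frame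
  have : Countable 𝒳 := h𝒳
  have : Countable Fml := Fml.code_injective.countable
  have : Nonempty (𝒳 ⊕ Fml × List (Option 𝒳)) := ⟨.inr (.fal, [])⟩
  obtain ⟨C, hC⟩ := F.exists_generic (ι := 𝒳 ⊕ Fml × List (Option 𝒳)) (fun i T => Sum.elim
    (fun X => ∀ C, F.Branch T C → C ≠ X.1)
    (fun i => i.1.IsElementary →
      (∀ C, F.Branch T C → (∀ x y y', Holds E i x y C → Holds E i x y' C → y = y') →
        ∀ a, ∃ b, ∀ y, E y b ↔ ∃ x, E x a ∧ Holds E i x y C) ∧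
      ((∃ X ∈ 𝒳, ∀ C, F.Branch T C → {x | Holds E i x x C} = X) ∨
        ∀ C, F.Branch T C → Dfn1 E (insert {x | Holds E i x x C} 𝒳) fun x => x ∈ C)) i) (by
    rintro (X | i) T hT
    · exact hT.exists_ne X
    · by_cases e : i.1.IsElementary
      · obtain ⟨T', h1, h2, h3⟩ := hT.exists_holds e
        exact ⟨T', h1, h2, fun _ => h3⟩
      · exact ⟨T, hT, fun p hp => hp, fun e' => (e e').elim⟩)
  refine ⟨C, fun hCX => ?_, fun i e => ?_⟩
  · obtain ⟨T, hT, hb⟩ := hC (.inl ⟨C, hCX⟩)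
    exact hT C hb rfl
  · obtain ⟨T, hT, hb⟩ := hC (.inr i)
    obtain ⟨h1, h2⟩ := hT e
    refine ⟨h1 C hb, h2.imp (fun ⟨X, hX, h'⟩ => ?_) fun h' => h' C hb⟩
    rw [h' C hb]
    exact hX

theorem GBC.extension (h : GBC Set.univ E 𝒳) {C : Set α}
    (hC : ∀ R, Dfn2 E (insert C 𝒳) R → (∀ x y y', R x y → R x y' → y = y') →
      ∀ a, ∃ b, ∀ y, E y b ↔ ∃ x, E x a ∧ R x y) :
    GBC Set.univ E {Y | Dfn1 E (insert C 𝒳) fun x => x ∈ Y} := by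
  have := h.params
  have hp : Params (insert C 𝒳) := .mono (𝒳 := 𝒳) (Set.subset_insert _ _)
  refine ⟨⟨fun _ _ => Set.subset_univ _, h.1.zf, fun R hR hfun a _ => ?_,
    fun φ e s _ c hc => ?_⟩, ?_⟩
  · simpa using hC _ (pairIn_dfn hR) hfun a
  · refine ⟨{x | Tr E φ (Function.update s 0 x) c}, ⟨?_⟩, fun x _ => ?_⟩
    · refine ((Dfn.tr e hc).comp (f := fun k v => if k = 0 then v 0 else s k) fun k => ?_).congr
        fun v => ?_
      · split_ifs
        exacts [.var 0, .const _]
      · apply iff_of_eq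
        simp only [Set.mem_ofPred_eq]
        congr 1
        funext n
        simp [Function.update_apply]
    · exact sat_elementary_iff e _ _
  · obtain ⟨G, hG, h'⟩ := h.2
    exact ⟨G, .of_mem (Set.mem_insert_of_mem _ hG), h'⟩

theorem GBC.exists_minimal_extension [Countable α] (h𝒳 : 𝒳.Countable) (h : GBC Set.univ E 𝒳) :
    ∃ 𝒴, GBC Set.univ E 𝒴 ∧ 𝒳 ⊂ 𝒴 ∧ ¬ ∃ 𝒵, GBC Set.univ E 𝒵 ∧ 𝒳 ⊂ 𝒵 ∧ 𝒵 ⊂ 𝒴 := by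
  obtain ⟨C, hC, hgen⟩ := h.exists_minimal_generic h𝒳
  refine ⟨{Y | Dfn1 E (insert C 𝒳) fun x => x ∈ Y}, h.extension fun R hR => ?_,
    ⟨fun Y hY => .of_mem (Set.mem_insert_of_mem _ hY), fun hs =>
      hC (hs (.of_mem (Set.mem_insert _ _)))⟩, ?_⟩
  · obtain ⟨i, e, hi⟩ := hR.exists_holds
    simpa only [hi] using (hgen i e).1
  · rintro ⟨𝒵, hZ, ⟨hXZ, hZX⟩, hZY, hYZ⟩
    obtain ⟨Y, hYZ', hYX⟩ := Set.not_subset.1 hZX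
    have hY : Dfn1 E (insert C 𝒳) fun x => x ∈ Y := hZY hYZ'
    obtain ⟨i, e, hi⟩ := Dfn2.exists_holds (R := fun x _ => x ∈ Y) ⟨hY.out⟩
    have hiY : {x | Holds E i x x C} = Y := Set.ext fun x => (hi x x).symm
    have hgen' := (hgen i e).2
    rw [hiY] at hgen'
    have hCY := hgen'.resolve_left hYX
    have hCZ : C ∈ 𝒵 := hZ.comprehension ⟨hCY.out.mono (Set.insert_subset hYZ' hXZ)⟩
    exact hYZ fun Y' (hY' : Dfn1 E (insert C 𝒳) fun x => x ∈ Y') =>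
      hZ.comprehension ⟨hY'.out.mono (Set.insert_subset hCZ hXZ)⟩

end Generic

/-- Every countable model of `GBC` admits a `GBC`-realization which is
minimal above its collection of classes. -/
theorem minimal_GBC_extension {α : Type} (E : α → α → Prop) (𝒳 : Set (Set α))
    (hcntM : Countable α) (hcnt𝒳 : 𝒳.Countable)
    (h : GBC (Set.univ : Set α) E 𝒳) :
    ∃ 𝒴 : Set (Set α), GBC Set.univ E 𝒴 ∧ 𝒳 ⊂ 𝒴 ∧
      ¬ ∃ 𝒵 : Set (Set α), GBC Set.univ E 𝒵 ∧ 𝒳 ⊂ 𝒵 ∧ 𝒵 ⊂ 𝒴 :=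
  h.exists_minimal_extension hcnt𝒳

end SOST
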